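/- For all integers g and r with 1 ≤ r ≤ g − 3, there exists a metric graph Γ of genus g carrying a free effective divisor D of degree 2r + 1 with rk(D) = r; in particular D has Clifford index deg(D) − 2·rk(D) = 1. -/

import Mathlib

noncomputable section

/-- The star with `n` rays of radius `r` in the complex plane:
`{ z ∈ ℂ : z = t·e^{2πik/n}, t ∈ [0,r], k ∈ ℤ }`. -/
def starSet (n : ℕ) (r : ℝ) : Set ℂ :=
  {z | ∃ t ∈ Set.Icc (0 : ℝ) r, ∃ k : ℤ,
    z = (t : ℂ) * Complex.exp (2 * (Real.pi : ℂ) * Complex.I * (k : ℂ) / (n : ℂ))}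

/-- `P` has a neighbourhood isometric to a star with `n` rays of some radius `r > 0`,
with `P` corresponding to `0`. -/
def HasStarNbhd (Γ : Type*) [MetricSpace Γ] (P : Γ) (n : ℕ) : Prop :=
  ∃ r > (0 : ℝ), ∃ U ∈ nhds P, ∃ φ : Γ → ℂ,
    φ P = 0 ∧ φ '' U = starSet n r ∧
    ∀ x ∈ U, ∀ y ∈ U, dist (φ x) (φ y) = dist x y

/-- A metric graph: a compact connected metric space in which every point has a
neighbourhood isometric to a star with `n ≥ 1` rays. -/
def IsMetricGraph (Γ : Type*) [MetricSpace Γ] : Prop :=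
  CompactSpace Γ ∧ ConnectedSpace Γ ∧ ∀ P : Γ, ∃ n : ℕ, 1 ≤ n ∧ HasStarNbhd Γ P n

/-- The valence of a point: the number of rays of a star neighbourhood. -/
noncomputable def valence (Γ : Type*) [MetricSpace Γ] (P : Γ) : ℕ :=
  sInf {n : ℕ | 1 ≤ n ∧ HasStarNbhd Γ P n}

/-- A vertex is a point of valence different from `2`. -/
def IsVertex (Γ : Type*) [MetricSpace Γ] (P : Γ) : Prop := valence Γ P ≠ 2

/-- The genus of a metric graph: `#edges - #vertices + 1`, the edges being the connected
components of the complement of the vertex set. -/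
noncomputable def graphGenus (Γ : Type*) [MetricSpace Γ] : ℤ :=
  (Nat.card (ConnectedComponents {P : Γ // ¬ IsVertex Γ P}) : ℤ)
    - (Nat.card {P : Γ // IsVertex Γ P} : ℤ) + 1

/-- A divisor on `Γ` : a finitely supported formal `ℤ`-linear combination of points. -/
abbrev Divisor (Γ : Type*) : Type _ := Γ →₀ ℤ

/-- The degree of a divisor. -/
def divDeg {Γ : Type*} (D : Divisor Γ) : ℤ := D.sum fun _ n => n

/-- A divisor is effective if all its coefficients are nonnegative. -/
def Effective {Γ : Type*} (D : Divisor Γ) : Prop := ∀ P : Γ, 0 ≤ D P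

/-- An arc based at `P` : an isometric parametrization of a segment emanating from `P`. -/
def IsArcAt {Γ : Type*} [MetricSpace Γ] (P : Γ) (τ : ℝ → Γ) : Prop :=
  τ 0 = P ∧ ∃ a > (0 : ℝ), ∀ s ∈ Set.Icc (0 : ℝ) a, ∀ t ∈ Set.Icc (0 : ℝ) a,
    dist (τ s) (τ t) = |s - t|

/-- Two arcs are equivalent (define the same tangent direction) when they agree near `0`. -/
def ArcEquiv {Γ : Type*} (τ τ' : ℝ → Γ) : Prop :=
  ∃ ε > (0 : ℝ), ∀ t ∈ Set.Icc (0 : ℝ) ε, τ t = τ' t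

/-- `f` has (one-sided) slope `s` along the arc `τ`. -/
def HasSlopeAlong {Γ : Type*} (f : Γ → ℝ) (τ : ℝ → Γ) (s : ℤ) : Prop :=
  ∃ ε > (0 : ℝ), ∀ t ∈ Set.Icc (0 : ℝ) ε, f (τ t) = f (τ 0) + (s : ℝ) * t

/-- A rational function on a metric graph: continuous and piecewise affine with
integer slopes, i.e. having an integer slope along every arc. -/
def IsRational (Γ : Type*) [MetricSpace Γ] (f : Γ → ℝ) : Prop :=
  Continuous f ∧ ∀ (P : Γ) (τ : ℝ → Γ), IsArcAt P τ → ∃ s : ℤ, HasSlopeAlong f τ s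

/-- `div f` has coefficient `m` at `P`: the sum of the slopes of `f` in all tangent
directions emanating from `P` equals `m`. -/
def HasOrderAt (Γ : Type*) [MetricSpace Γ] (f : Γ → ℝ) (P : Γ) (m : ℤ) : Prop :=
  ∃ (n : ℕ) (τ : Fin n → ℝ → Γ) (s : Fin n → ℤ),
    (∀ i, IsArcAt P (τ i)) ∧
    Pairwise (fun i j => ¬ ArcEquiv (τ i) (τ j)) ∧
    (∀ σ : ℝ → Γ, IsArcAt P σ → ∃ i, ArcEquiv σ (τ i)) ∧
    (∀ i, HasSlopeAlong f (τ i) (s i)) ∧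
    m = ∑ i, s i

/-- Linear equivalence of divisors: `D₂ - D₁ = div f` for some rational function `f`. -/
def LinEquiv (Γ : Type*) [MetricSpace Γ] (D₁ D₂ : Divisor Γ) : Prop :=
  ∃ f : Γ → ℝ, IsRational Γ f ∧ ∀ P : Γ, HasOrderAt Γ f P (D₂ P - D₁ P)

/-- `D` is linearly equivalent to an effective divisor. -/
def EquivEffective (Γ : Type*) [MetricSpace Γ] (D : Divisor Γ) : Prop :=
  ∃ D' : Divisor Γ, Effective D' ∧ LinEquiv Γ D D'

/-- For every effective divisor `E` of degree `r`, `D - E` is linearly equivalent to an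
effective divisor. -/
def RankGE (Γ : Type*) [MetricSpace Γ] (D : Divisor Γ) (r : ℕ) : Prop :=
  ∀ E : Divisor Γ, Effective E → divDeg E = (r : ℤ) → EquivEffective Γ (D - E)

/-- The rank of a divisor: `-1` if `D` is not equivalent to an effective divisor, and
otherwise the largest `r ≥ 0` such that `D - E` is equivalent to an effective divisor
for every effective `E` of degree `r`. -/
noncomputable def divRank (Γ : Type*) [MetricSpace Γ] (D : Divisor Γ) : ℤ :=
  sSup (insert (-1) {n : ℤ | ∃ r : ℕ, n = (r : ℤ) ∧ RankGE Γ D r})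

/-- The arc `τ` immediately leaves the set `X`. -/
def ArcLeaves {Γ : Type*} (X : Set Γ) (τ : ℝ → Γ) : Prop :=
  ∃ ε > (0 : ℝ), ∀ t ∈ Set.Ioc (0 : ℝ) ε, τ t ∉ X

/-- `P` is a non-saturated boundary point of `X` with respect to `D` : the number of
tangent directions at `P` leaving `X` is strictly greater than `D P`. -/
def NonSaturated (Γ : Type*) [MetricSpace Γ] (D : Divisor Γ) (X : Set Γ) (P : Γ) : Prop :=
  P ∈ frontier X ∧ ∃ (n : ℕ) (τ : Fin n → ℝ → Γ),
    (∀ i, IsArcAt P (τ i)) ∧ (∀ i, ArcLeaves X (τ i)) ∧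
    Pairwise (fun i j => ¬ ArcEquiv (τ i) (τ j)) ∧ D P < (n : ℤ)

/-- `D` is `P₀`-reduced. -/
def IsReducedDivisor (Γ : Type*) [MetricSpace Γ] (D : Divisor Γ) (P₀ : Γ) : Prop :=
  (∀ P : Γ, P ≠ P₀ → 0 ≤ D P) ∧
  ∀ X : Set Γ, IsClosed X → X.Nonempty → P₀ ∉ X → ∃ P, NonSaturated Γ D X P

/-- The restriction of a divisor on `Γ` to a divisor on a subset `S` (with the induced
metric); divisors supported on `S` are identified with divisors on `S` this way. -/
noncomputable def DivRestrict {Γ : Type*} (S : Set Γ) (D : Divisor Γ) : Divisor ↥S :=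
  Finsupp.comapDomain Subtype.val D Subtype.coe_injective.injOn

/-- Linear equivalence computed on the subgraph `S` of `Γ`. -/
def LinEquivOn {Γ : Type*} [MetricSpace Γ] (S : Set Γ) (D₁ D₂ : Divisor Γ) : Prop :=
  LinEquiv ↥S (DivRestrict S D₁) (DivRestrict S D₂)

/-- The rank computed on the subgraph `S` of `Γ`. -/
noncomputable def divRankOn {Γ : Type*} [MetricSpace Γ] (S : Set Γ) (D : Divisor Γ) : ℤ :=
  divRank ↥S (DivRestrict S D)

/-- A free divisor: effective, of rank at least one, and removing any point decreases
the rank. -/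
def IsFreeDivisor (Γ : Type*) [MetricSpace Γ] (D : Divisor Γ) : Prop :=
  Effective D ∧ 1 ≤ divRank Γ D ∧
  ∀ P : Γ, divRank Γ (D - Finsupp.single P 1) < divRank Γ D

/-- The canonical divisor `K_Γ = Σ_P (val(P) - 2)·P`. -/
def IsCanonical (Γ : Type*) [MetricSpace Γ] (K : Divisor Γ) : Prop :=
  ∀ P : Γ, K P = (valence Γ P : ℤ) - 2

/-- A very special divisor: effective with `rk(D) > 0` and `rk(K_Γ - D) > 0`. -/
def VerySpecial (Γ : Type*) [MetricSpace Γ] (D : Divisor Γ) : Prop :=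
  Effective D ∧ 0 < divRank Γ D ∧
  ∃ K : Divisor Γ, IsCanonical Γ K ∧ 0 < divRank Γ (K - D)

/-- `φ` is an `L`-periodic locally isometric parametrization of the circle `S ⊆ Γ`
of circumference `L`. -/
def CircleParam {Γ : Type*} [MetricSpace Γ] (S : Set Γ) (L : ℝ) (φ : ℝ → Γ) : Prop :=
  0 < L ∧ (∀ t : ℝ, φ (t + L) = φ t) ∧ Set.range φ = S ∧
  ∀ s t : ℝ, |s - t| ≤ L / 2 → dist (φ s) (φ t) = |s - t|

/-- `S` is a metric circle inside `Γ`. -/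
def IsCircleSet {Γ : Type*} [MetricSpace Γ] (S : Set Γ) : Prop :=
  ∃ (L : ℝ) (φ : ℝ → Γ), CircleParam S L φ

end
/-- A bundled metric graph. -/
structure MetricGraph : Type 1 where
  carrier : Type
  [ms : MetricSpace carrier]
  graph : IsMetricGraph carrier

attribute [instance] MetricGraph.ms

/-- A metric graph `G` obtained from a metric graph `G₀` by attaching a loop `γ`
(a metric circle) at a point `v ∈ G₀`. -/
structure LoopAttachment : Type 1 where
  G : Type
  [ms : MetricSpace G]
  graph : IsMetricGraph G
  G₀ : Set G
  γ : Set G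
  v : G
  hv : v ∈ G₀
  closed₀ : IsClosed G₀
  closedγ : IsClosed γ
  cover : G₀ ∪ γ = Set.univ
  meet : G₀ ∩ γ = {v}
  graph₀ : IsMetricGraph ↥G₀
  circleγ : IsCircleSet γ

attribute [instance] LoopAttachment.ms

section

open Set Filter Topology

/-- The unit vector spanning the `i`-th ray of the star with `n` rays. -/
noncomputable def starDir (n : ℕ) (i : Fin n) : ℂ :=
  Complex.exp (2 * (Real.pi : ℂ) * Complex.I * ((i : ℕ) : ℂ) / (n : ℂ))

lemma norm_exp_star (n : ℕ) (k : ℤ) :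
    ‖Complex.exp (2 * (Real.pi : ℂ) * Complex.I * (k : ℂ) / (n : ℂ))‖ = 1 := by
  have : 2 * (Real.pi : ℂ) * Complex.I * (k : ℂ) / (n : ℂ)
      = ((2 * Real.pi * k / n : ℝ) : ℂ) * Complex.I := by
    push_cast; ring
  rw [this, Complex.norm_exp_ofReal_mul_I]

lemma norm_starDir (n : ℕ) (i : Fin n) : ‖starDir n i‖ = 1 := by
  have := norm_exp_star n (i : ℤ)
  simpa [starDir] using this

lemma exp_star_emod (n : ℕ) (hn : n ≠ 0) (k : ℤ) :
    Complex.exp (2 * (Real.pi : ℂ) * Complex.I * (k : ℂ) / (n : ℂ))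
      = Complex.exp (2 * (Real.pi : ℂ) * Complex.I * ((k % (n : ℤ) : ℤ) : ℂ) / (n : ℂ)) := by
  rw [Complex.exp_eq_exp_iff_exists_int]
  refine ⟨k / n, ?_⟩
  have h : (k : ℂ) = ((k % (n : ℤ) : ℤ) : ℂ) + (n : ℂ) * ((k / (n : ℤ) : ℤ) : ℂ) := by
    have := Int.emod_add_mul_ediv k n
    exact_mod_cast this.symm
  have hn' : (n : ℂ) ≠ 0 := by exact_mod_cast hn
  rw [h]
  field_simp

lemma starDir_injective (n : ℕ) : Function.Injective (starDir n) := by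
  intro i j h
  have hn : n ≠ 0 := by rintro rfl; exact i.elim0
  have hn' : (n : ℂ) ≠ 0 := by exact_mod_cast hn
  have hp := Complex.isPrimitiveRoot_exp n hn
  have key : ∀ k : Fin n, starDir n k
      = Complex.exp (2 * (Real.pi : ℂ) * Complex.I / (n : ℂ)) ^ (k : ℕ) := by
    intro k
    rw [← Complex.exp_nat_mul, starDir]
    congr 1
    ring
  rw [key, key] at h
  exact Fin.ext (hp.pow_inj i.2 j.2 h)

/-- A polar chart around `P`: `n` arcs emanating from `P`, parametrized on `[0, ρ]`, covering the
closed ball of radius `ρ` and metrically arranged like the rays of a star. -/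
structure IsStarChart {Γ : Type*} [MetricSpace Γ] (P : Γ) (n : ℕ) (σ : Fin n → ℝ → Γ)
    (ρ : ℝ) : Prop where
  pos : 0 < ρ
  dist_eq : ∀ i j, ∀ s ∈ Icc (0 : ℝ) ρ, ∀ t ∈ Icc (0 : ℝ) ρ,
    dist (σ i s) (σ j t) = ‖(s : ℂ) * starDir n i - (t : ℂ) * starDir n j‖
  zero : ∀ i, σ i 0 = P
  surj : ∀ Q, dist P Q ≤ ρ → ∃ i, Q = σ i (dist P Q)

lemma ArcEquiv.symm {Γ : Type*} {τ τ' : ℝ → Γ} (h : ArcEquiv τ τ') : ArcEquiv τ' τ := by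
  obtain ⟨ε, h0, h⟩ := h
  exact ⟨ε, h0, fun t ht => (h t ht).symm⟩

lemma ArcEquiv.trans {Γ : Type*} {τ τ' τ'' : ℝ → Γ} (h : ArcEquiv τ τ') (h' : ArcEquiv τ' τ'') :
    ArcEquiv τ τ'' := by
  obtain ⟨ε, h0, h⟩ := h
  obtain ⟨ε', h0', h'⟩ := h'
  refine ⟨min ε ε', lt_min h0 h0', fun t ht => ?_⟩
  rw [h t ⟨ht.1, ht.2.trans (min_le_left _ _)⟩, h' t ⟨ht.1, ht.2.trans (min_le_right _ _)⟩]

lemma HasSlopeAlong.congr {Γ : Type*} {f : Γ → ℝ} {τ τ' : ℝ → Γ} {s : ℤ}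
    (h : HasSlopeAlong f τ s) (e : ArcEquiv τ' τ) : HasSlopeAlong f τ' s := by
  obtain ⟨ε, h0, h⟩ := h
  obtain ⟨ε', h0', h'⟩ := e
  refine ⟨min ε ε', lt_min h0 h0', fun t ht => ?_⟩
  rw [h' t ⟨ht.1, ht.2.trans (min_le_right _ _)⟩, h' 0 ⟨le_rfl, h0'.le⟩,
    h t ⟨ht.1, ht.2.trans (min_le_left _ _)⟩]

lemma HasSlopeAlong.add {Γ : Type*} {f g : Γ → ℝ} {τ : ℝ → Γ} {s s' : ℤ}
    (h : HasSlopeAlong f τ s) (h' : HasSlopeAlong g τ s') :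
    HasSlopeAlong (fun x => f x + g x) τ (s + s') := by
  obtain ⟨ε, h0, h⟩ := h
  obtain ⟨ε', h0', h'⟩ := h'
  refine ⟨min ε ε', lt_min h0 h0', fun t ht => ?_⟩
  dsimp only
  rw [h t ⟨ht.1, ht.2.trans (min_le_left _ _)⟩, h' t ⟨ht.1, ht.2.trans (min_le_right _ _)⟩]
  push_cast
  ring

lemma HasSlopeAlong.neg {Γ : Type*} {f : Γ → ℝ} {τ : ℝ → Γ} {s : ℤ}
    (h : HasSlopeAlong f τ s) : HasSlopeAlong (fun x => - f x) τ (-s) := by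
  obtain ⟨ε, h0, h⟩ := h
  refine ⟨ε, h0, fun t ht => ?_⟩
  dsimp only
  rw [h t ht]
  push_cast
  ring

namespace IsStarChart

variable {Γ : Type*} [MetricSpace Γ] {P : Γ} {n : ℕ} {σ : Fin n → ℝ → Γ} {ρ : ℝ}

lemma dist_center (h : IsStarChart P n σ ρ) (i : Fin n) {t : ℝ} (ht : t ∈ Icc (0 : ℝ) ρ) :
    dist P (σ i t) = t := by
  rw [← h.zero i, h.dist_eq i i 0 ⟨le_rfl, h.pos.le⟩ t ht]
  simp [norm_starDir, abs_of_nonneg ht.1]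

lemma dist_same (h : IsStarChart P n σ ρ) (i : Fin n) {s t : ℝ} (hs : s ∈ Icc (0 : ℝ) ρ)
    (ht : t ∈ Icc (0 : ℝ) ρ) : dist (σ i s) (σ i t) = |s - t| := by
  rw [h.dist_eq i i s hs t ht, ← sub_mul, norm_mul, norm_starDir, mul_one, ← Complex.ofReal_sub,
    Complex.norm_real, Real.norm_eq_abs]

lemma eq_of_dist (h : IsStarChart P n σ ρ) {i j : Fin n} {s t : ℝ} (hs : s ∈ Ioc (0 : ℝ) ρ)
    (ht : t ∈ Ioc (0 : ℝ) ρ) (hd : dist (σ i s) (σ j t) = |s - t|) : i = j := by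
  rw [h.dist_eq i j s ⟨hs.1.le, hs.2⟩ t ⟨ht.1.le, ht.2⟩] at hd
  apply starDir_injective n
  have hi := norm_starDir n i
  have hj := norm_starDir n j
  have hst : 0 < s * t := mul_pos hs.1 ht.1
  have hd2 := congrArg (· ^ 2) hd
  have hi2 := congrArg (· ^ 2) hi
  have hj2 := congrArg (· ^ 2) hj
  simp only [Complex.sq_norm, Complex.normSq_apply, sq_abs, Complex.sub_re, Complex.sub_im,
    Complex.re_ofReal_mul, Complex.im_ofReal_mul] at hd2 hi2 hj2
  set a := (starDir n i).re
  set b := (starDir n i).im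
  set c := (starDir n j).re
  set d := (starDir n j).im
  have key : s * t * ((a - c) ^ 2 + (b - d) ^ 2) = 0 := by
    linear_combination hd2 + (s * t - s ^ 2) * hi2 + (s * t - t ^ 2) * hj2
  have key2 : (a - c) ^ 2 + (b - d) ^ 2 = 0 := (mul_eq_zero.mp key).resolve_left hst.ne'
  refine Complex.ext ?_ ?_
  · nlinarith [sq_nonneg (a - c), sq_nonneg (b - d)]
  · nlinarith [sq_nonneg (a - c), sq_nonneg (b - d)]

lemma isArcAt (h : IsStarChart P n σ ρ) (i : Fin n) : IsArcAt P (σ i) :=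
  ⟨h.zero i, ρ, h.pos, fun _ hs _ ht => h.dist_same i hs ht⟩

lemma not_arcEquiv (h : IsStarChart P n σ ρ) {i j : Fin n} (hij : i ≠ j) :
    ¬ ArcEquiv (σ i) (σ j) := by
  rintro ⟨ε, h0, he⟩
  have hm : 0 < min ε ρ := lt_min h0 h.pos
  have := he (min ε ρ) ⟨hm.le, min_le_left _ _⟩
  refine hij (h.eq_of_dist (s := min ε ρ) (t := min ε ρ) ⟨hm, min_le_right _ _⟩
    ⟨hm, min_le_right _ _⟩ ?_)
  rw [this, sub_self, abs_zero, dist_self]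

lemma exists_arcEquiv (h : IsStarChart P n σ ρ) {τ : ℝ → Γ} (hτ : IsArcAt P τ) :
    ∃ i, ArcEquiv τ (σ i) := by
  obtain ⟨h0, a, ha, hd⟩ := hτ
  set b := min a ρ with hb
  have hb0 : 0 < b := lt_min ha h.pos
  have hba : b ≤ a := min_le_left _ _
  have hbρ : b ≤ ρ := min_le_right _ _
  have hP : ∀ t ∈ Icc (0 : ℝ) b, dist P (τ t) = t := by
    intro t ht
    rw [← h0, hd 0 ⟨le_rfl, ha.le⟩ t ⟨ht.1, ht.2.trans hba⟩, zero_sub, abs_neg, abs_of_nonneg ht.1]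
  have hex : ∀ t ∈ Icc (0 : ℝ) b, ∃ i, τ t = σ i t := by
    intro t ht
    obtain ⟨i, hi⟩ := h.surj (τ t) (by rw [hP t ht]; exact ht.2.trans hbρ)
    rw [hP t ht] at hi
    exact ⟨i, hi⟩
  obtain ⟨i, hi⟩ := hex b ⟨hb0.le, le_rfl⟩
  refine ⟨i, b, hb0, fun t ht => ?_⟩
  rcases ht.1.eq_or_lt with rfl | htp
  · rw [h0, h.zero]
  obtain ⟨j, hj⟩ := hex t ht
  have : j = i := by
    refine h.eq_of_dist (s := t) (t := b) ⟨htp, ht.2.trans hbρ⟩ ⟨hb0, hbρ⟩ ?_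
    rw [← hj, ← hi, hd t ⟨ht.1, ht.2.trans hba⟩ b ⟨hb0.le, hba⟩]
  rw [hj, this]

lemma hasOrderAt (h : IsStarChart P n σ ρ) {f : Γ → ℝ} {s : Fin n → ℤ}
    (hs : ∀ i, HasSlopeAlong f (σ i) (s i)) : HasOrderAt Γ f P (∑ i, s i) :=
  ⟨n, σ, s, h.isArcAt, fun _ _ hij => h.not_arcEquiv hij, fun _ hτ => h.exists_arcEquiv hτ, hs, rfl⟩

lemma exists_slopes (h : IsStarChart P n σ ρ) {f : Γ → ℝ} {m : ℤ} (hm : HasOrderAt Γ f P m) :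
    ∃ s : Fin n → ℤ, (∀ i, HasSlopeAlong f (σ i) (s i)) ∧ m = ∑ i, s i := by
  obtain ⟨n', τ, s', harc, hne, hcomp, hsl, rfl⟩ := hm
  choose e he using fun i => hcomp (σ i) (h.isArcAt i)
  have hinj : Function.Injective e := by
    intro i j hij
    by_contra hc
    refine h.not_arcEquiv hc ((he i).trans ?_)
    rw [hij]
    exact (he j).symm
  have hsurj : Function.Surjective e := by
    intro k
    obtain ⟨i, hi⟩ := h.exists_arcEquiv (harc k)
    refine ⟨i, ?_⟩
    by_contra hc
    exact hne hc ((he i).symm.trans hi.symm)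
  refine ⟨fun i => s' (e i), fun i => (hsl (e i)).congr (he i), ?_⟩
  exact (Function.Bijective.sum_comp ⟨hinj, hsurj⟩ s').symm

lemma exists_slope_of_arc (h : IsStarChart P n σ ρ) {f : Γ → ℝ}
    (hs : ∀ i, ∃ s, HasSlopeAlong f (σ i) s) {τ : ℝ → Γ} (hτ : IsArcAt P τ) :
    ∃ s, HasSlopeAlong f τ s := by
  obtain ⟨i, hi⟩ := h.exists_arcEquiv hτ
  obtain ⟨s, hs⟩ := hs i
  exact ⟨s, hs.congr hi⟩

lemma continuousAt (h : IsStarChart P n σ ρ) {f : Γ → ℝ}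
    (hs : ∀ i, ∃ s, HasSlopeAlong f (σ i) s) : ContinuousAt f P := by
  choose s hs using hs
  choose ε hε hf using hs
  have h1 : ∀ᶠ Q in 𝓝 P, dist P Q ≤ ρ := by
    filter_upwards [Metric.closedBall_mem_nhds P h.pos] with Q hQ
    rw [dist_comm]; exact hQ
  have h2 : ∀ᶠ Q in 𝓝 P, ∀ i, dist P Q ≤ ε i := by
    rw [eventually_all]
    intro i
    filter_upwards [Metric.closedBall_mem_nhds P (hε i)] with Q hQ
    rw [dist_comm]; exact hQ
  have h3 : ∀ᶠ Q in 𝓝 P, dist (f Q) (f P) ≤ (∑ i, |(s i : ℝ)|) * dist P Q := by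
    filter_upwards [h1, h2] with Q hQ hQ2
    obtain ⟨i, hi⟩ := h.surj Q hQ
    have := hf i (dist P Q) ⟨dist_nonneg, hQ2 i⟩
    rw [← hi, h.zero] at this
    rw [this, Real.dist_eq, add_sub_cancel_left, abs_mul, abs_of_nonneg (dist_nonneg (x := P))]
    refine mul_le_mul_of_nonneg_right ?_ dist_nonneg
    exact Finset.single_le_sum (f := fun i => |(s i : ℝ)|) (fun _ _ => abs_nonneg _)
      (Finset.mem_univ i)
  rw [ContinuousAt, tendsto_iff_dist_tendsto_zero]
  refine squeeze_zero' (Eventually.of_forall fun _ => dist_nonneg) h3 ?_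
  have : Tendsto (fun Q => (∑ i, |(s i : ℝ)|) * dist P Q) (𝓝 P)
      (𝓝 ((∑ i, |(s i : ℝ)|) * dist P P)) :=
    (Continuous.tendsto (by fun_prop) P)
  simpa using this

lemma one_le (h : IsStarChart P n σ ρ) : 1 ≤ n := by
  obtain ⟨i, -⟩ := h.surj P (by simpa using h.pos.le)
  exact i.pos

lemma hasStarNbhd (h : IsStarChart P n σ ρ) : HasStarNbhd Γ P n := by
  classical
  have hn : n ≠ 0 := Nat.one_le_iff_ne_zero.mp h.one_le
  refine ⟨ρ, h.pos, Metric.closedBall P ρ, Metric.closedBall_mem_nhds P h.pos,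
    fun Q => if hQ : dist P Q ≤ ρ then
      (dist P Q : ℂ) * starDir n ((h.surj Q hQ).choose) else 0, ?_, ?_, ?_⟩
  · simp
  · ext z
    constructor
    · rintro ⟨Q, hQ, rfl⟩
      have hQ' : dist P Q ≤ ρ := by rw [dist_comm]; exact hQ
      refine ⟨dist P Q, ⟨dist_nonneg, hQ'⟩, ((h.surj Q hQ').choose : ℕ), ?_⟩
      simp only [hQ', dif_pos, starDir]
      norm_cast
    · rintro ⟨t, ht, k, rfl⟩
      have hk0 : 0 ≤ k % (n : ℤ) := Int.emod_nonneg _ (by exact_mod_cast hn)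
      have hk1 : k % (n : ℤ) < n := Int.emod_lt_of_pos _ (by omega)
      set i : Fin n := ⟨(k % (n : ℤ)).toNat, by omega⟩ with hi
      have hd : dist P (σ i t) = t := h.dist_center i ht
      refine ⟨σ i t, by rw [Metric.mem_closedBall, dist_comm, hd]; exact ht.2, ?_⟩
      have hle : dist P (σ i t) ≤ ρ := by rw [hd]; exact ht.2
      simp only [hle, dif_pos]
      have hs := (h.surj _ hle).choose_spec
      set j := (h.surj _ hle).choose
      rw [hd] at hs ⊢
      rcases ht.1.eq_or_lt with rfl | htp
      · simp
      have : i = j := by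
        refine h.eq_of_dist (s := t) (t := t) ⟨htp, ht.2⟩ ⟨htp, ht.2⟩ ?_
        rw [← hs, dist_self, sub_self, abs_zero]
      rw [← this, exp_star_emod n hn k, starDir]
      have h5 : (((k % (n : ℤ)).toNat : ℕ) : ℂ) = ((k % (n : ℤ) : ℤ) : ℂ) := by
        have : (((k % (n : ℤ)).toNat : ℕ) : ℤ) = k % (n : ℤ) := Int.toNat_of_nonneg hk0
        exact_mod_cast congrArg (Int.cast : ℤ → ℂ) this
      rw [hi]
      simp only [h5]
  · intro x hx y hy
    have hx' : dist P x ≤ ρ := by rw [dist_comm]; exact hx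
    have hy' : dist P y ≤ ρ := by rw [dist_comm]; exact hy
    simp only [hx', hy', dif_pos]
    have h1 := (h.surj x hx').choose_spec
    have h2 := (h.surj y hy').choose_spec
    rw [Complex.dist_eq, ← h.dist_eq _ _ _ ⟨dist_nonneg, hx'⟩ _ ⟨dist_nonneg, hy'⟩, ← h1, ← h2]

lemma le_of_hasStarNbhd (h : IsStarChart P n σ ρ) {n' : ℕ} (hn' : 1 ≤ n')
    (hs : HasStarNbhd Γ P n') : n ≤ n' := by
  obtain ⟨r, hr, U, hU, φ, hφ0, himg, hiso⟩ := hs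
  obtain ⟨ε, hε, hball⟩ := Metric.mem_nhds_iff.mp hU
  set t := min (ε / 2) ρ with ht
  have ht0 : 0 < t := lt_min (by positivity) h.pos
  have htρ : t ≤ ρ := min_le_right _ _
  have htε : t < ε := lt_of_le_of_lt (min_le_left _ _) (by linarith)
  have hmem : ∀ i, σ i t ∈ U := fun i => hball (by
    rw [Metric.mem_ball, dist_comm, h.dist_center i ⟨ht0.le, htρ⟩]; exact htε)
  have hPU : P ∈ U := mem_of_mem_nhds hU
  have hk : ∀ i, ∃ k : ℤ, φ (σ i t)
      = (t : ℂ) * Complex.exp (2 * (Real.pi : ℂ) * Complex.I * (k : ℂ) / (n' : ℂ)) := by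
    intro i
    have h1 : φ (σ i t) ∈ starSet n' r := himg ▸ mem_image_of_mem φ (hmem i)
    obtain ⟨u, hu, k, hk⟩ := h1
    refine ⟨k, ?_⟩
    have h2 := hiso P hPU _ (hmem i)
    rw [h.dist_center i ⟨ht0.le, htρ⟩, hφ0, dist_zero_left, hk, norm_mul, norm_exp_star, mul_one,
      Complex.norm_real, Real.norm_eq_abs, abs_of_nonneg hu.1] at h2
    rw [hk, h2]
  choose k hk using hk
  have hn0 : n' ≠ 0 := by omega
  have hb : ∀ i, (k i % (n' : ℤ)).toNat < n' := fun i => by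
    have := Int.emod_lt_of_pos (k i) (b := (n' : ℤ)) (by omega)
    have := Int.emod_nonneg (k i) (b := (n' : ℤ)) (by omega)
    omega
  have hinj : Function.Injective (fun i => (⟨(k i % (n' : ℤ)).toNat, hb i⟩ : Fin n')) := by
    intro i j hij
    have h1 : (k i % (n' : ℤ)).toNat = (k j % (n' : ℤ)).toNat := Fin.mk.inj_iff.mp hij
    have h2 := Int.emod_nonneg (k i) (b := (n' : ℤ)) (by omega)
    have h3 := Int.emod_nonneg (k j) (b := (n' : ℤ)) (by omega)
    have h4 : k i % (n' : ℤ) = k j % (n' : ℤ) := by omega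
    have h5 : φ (σ i t) = φ (σ j t) := by
      rw [hk i, hk j, exp_star_emod n' hn0 (k i), exp_star_emod n' hn0 (k j), h4]
    have h6 := hiso _ (hmem i) _ (hmem j)
    rw [h5, dist_self] at h6
    exact h.eq_of_dist (s := t) (t := t) ⟨ht0, htρ⟩ ⟨ht0, htρ⟩ (by rw [← h6]; simp)
  simpa using Fintype.card_le_of_injective _ hinj

lemma valence_eq (h : IsStarChart P n σ ρ) : valence Γ P = n :=
  IsLeast.csInf_eq ⟨⟨h.one_le, h.hasStarNbhd⟩, fun _ hk => h.le_of_hasStarNbhd hk.1 hk.2⟩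

end IsStarChart

section ChartedGraph

variable {Γ : Type*} [MetricSpace Γ]

/-- Every point admits a polar chart. -/
def HasStarCharts (Γ : Type*) [MetricSpace Γ] : Prop :=
  ∀ P : Γ, ∃ (n : ℕ) (σ : Fin n → ℝ → Γ) (ρ : ℝ), IsStarChart P n σ ρ

/-- `A` is the divisor of a rational function. -/
def IsPrincipalDivisor (A : Divisor Γ) : Prop :=
  ∃ f : Γ → ℝ, IsRational Γ f ∧ ∀ P : Γ, HasOrderAt Γ f P (A P)

lemma linEquiv_iff {D₁ D₂ : Divisor Γ} : LinEquiv Γ D₁ D₂ ↔ IsPrincipalDivisor (D₂ - D₁) := by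
  simp [LinEquiv, IsPrincipalDivisor]

lemma IsRational.add {f g : Γ → ℝ} (hf : IsRational Γ f) (hg : IsRational Γ g) :
    IsRational Γ (fun x => f x + g x) := by
  refine ⟨hf.1.add hg.1, fun P τ hτ => ?_⟩
  obtain ⟨s, hs⟩ := hf.2 P τ hτ
  obtain ⟨s', hs'⟩ := hg.2 P τ hτ
  exact ⟨_, hs.add hs'⟩

lemma IsRational.neg {f : Γ → ℝ} (hf : IsRational Γ f) : IsRational Γ (fun x => - f x) := by
  refine ⟨hf.1.neg, fun P τ hτ => ?_⟩
  obtain ⟨s, hs⟩ := hf.2 P τ hτ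
  exact ⟨_, hs.neg⟩

lemma HasOrderAt.add (hc : HasStarCharts Γ) {f g : Γ → ℝ} {P : Γ} {m m' : ℤ}
    (hf : HasOrderAt Γ f P m) (hg : HasOrderAt Γ g P m') :
    HasOrderAt Γ (fun x => f x + g x) P (m + m') := by
  obtain ⟨n, σ, ρ, h⟩ := hc P
  obtain ⟨s, hs, rfl⟩ := h.exists_slopes hf
  obtain ⟨s', hs', rfl⟩ := h.exists_slopes hg
  rw [← Finset.sum_add_distrib]
  exact h.hasOrderAt fun i => (hs i).add (hs' i)

lemma HasOrderAt.neg {f : Γ → ℝ} {P : Γ} {m : ℤ} (hf : HasOrderAt Γ f P m) :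
    HasOrderAt Γ (fun x => - f x) P (-m) := by
  obtain ⟨n, τ, s, h1, h2, h3, h4, rfl⟩ := hf
  exact ⟨n, τ, fun i => -s i, h1, h2, h3, fun i => (h4 i).neg, by simp⟩

lemma isRational_of_slopes
    (f : Γ → ℝ) (h : ∀ P : Γ, ∃ (n : ℕ) (σ : Fin n → ℝ → Γ) (ρ : ℝ), IsStarChart P n σ ρ ∧
      ∀ i, ∃ s, HasSlopeAlong f (σ i) s) : IsRational Γ f := by
  refine ⟨continuous_iff_continuousAt.mpr fun P => ?_, fun P τ hτ => ?_⟩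
  · obtain ⟨n, σ, ρ, hP, hs⟩ := h P
    exact hP.continuousAt hs
  · obtain ⟨n, σ, ρ, hP, hs⟩ := h P
    exact hP.exists_slope_of_arc hs hτ

/-- The group of principal divisors. -/
def principalDivisors (hc : HasStarCharts Γ) : AddSubgroup (Divisor Γ) where
  carrier := {A | IsPrincipalDivisor A}
  add_mem' := by
    rintro A B ⟨f, hf, hA⟩ ⟨g, hg, hB⟩
    exact ⟨_, hf.add hg, fun P => (hA P).add hc (hB P)⟩
  zero_mem' := by
    have hs : ∀ τ : ℝ → Γ, HasSlopeAlong (fun _ : Γ => (0 : ℝ)) τ 0 :=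
      fun τ => ⟨1, one_pos, by simp⟩
    refine ⟨fun _ => 0, ⟨continuous_const, fun P τ _ => ⟨0, hs τ⟩⟩, fun P => ?_⟩
    obtain ⟨n, σ, ρ, h⟩ := hc P
    simpa using h.hasOrderAt (f := fun _ : Γ => (0 : ℝ)) (s := fun _ => 0) fun i => hs _
  neg_mem' := by
    rintro A ⟨f, hf, hA⟩
    exact ⟨_, hf.neg, fun P => (hA P).neg⟩

lemma mem_principalDivisors {hc : HasStarCharts Γ} {A : Divisor Γ} :
    A ∈ principalDivisors hc ↔ IsPrincipalDivisor A := Iff.rfl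

lemma equivEffective_iff (hc : HasStarCharts Γ) {D : Divisor Γ} :
    EquivEffective Γ D ↔ ∃ B : Divisor Γ, Effective B ∧ B - D ∈ principalDivisors hc := by
  simp only [EquivEffective, linEquiv_iff, mem_principalDivisors]

lemma divDeg_add {Γ : Type*} (A B : Divisor Γ) : divDeg (A + B) = divDeg A + divDeg B :=
  Finsupp.sum_add_index' (fun _ => rfl) (fun _ _ _ => rfl)

lemma divDeg_single {Γ : Type*} (P : Γ) (n : ℤ) : divDeg (Finsupp.single P n) = n := by
  simp [divDeg]

lemma divDeg_sum {Γ ι : Type*} (s : Finset ι) (A : ι → Divisor Γ) :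
    divDeg (∑ i ∈ s, A i) = ∑ i ∈ s, divDeg (A i) := by
  classical
  induction s using Finset.induction_on with
  | empty => simp [divDeg]
  | insert a s ha ih => rw [Finset.sum_insert ha, Finset.sum_insert ha, divDeg_add, ih]

lemma Effective.add {Γ : Type*} {A B : Divisor Γ} (hA : Effective A) (hB : Effective B) :
    Effective (A + B) := fun P => by
  simpa using add_nonneg (hA P) (hB P)

lemma Effective.single {Γ : Type*} (P : Γ) {n : ℤ} (hn : 0 ≤ n) :
    Effective (Finsupp.single P n) := by
  classical
  intro Q
  rw [Finsupp.single_apply]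
  split_ifs
  exacts [hn, le_rfl]

lemma Effective.sum {Γ ι : Type*} {s : Finset ι} {A : ι → Divisor Γ}
    (h : ∀ i ∈ s, Effective (A i)) : Effective (∑ i ∈ s, A i) := fun P => by
  rw [Finsupp.finsetSum_apply]
  exact Finset.sum_nonneg fun i hi => h i hi P

/-- Induction on effective divisors, adding one point at a time. -/
lemma Effective.induction {Γ : Type*} {p : Divisor Γ → ℕ → Prop} (h0 : p 0 0)
    (hadd : ∀ (E : Divisor Γ) (n : ℕ) (P : Γ), p E n → p (E + Finsupp.single P 1) (n + 1))
    (n : ℕ) (E : Divisor Γ) (hE : Effective E) (hn : divDeg E = n) : p E n := by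
  classical
  induction n generalizing E with
  | zero =>
    have : E = 0 := by
      ext P
      by_contra hP
      have hmem : P ∈ E.support := by simpa using hP
      have := Finset.single_le_sum (f := fun Q => E Q) (fun Q _ => hE Q) hmem
      have hd : divDeg E = ∑ Q ∈ E.support, E Q := rfl
      have h1 := hE P
      simp only [Finsupp.coe_zero, Pi.zero_apply] at hP
      rw [← hd, hn] at this
      simp only [Nat.cast_zero] at this
      exact hP (le_antisymm this h1)
    rw [this]; exact h0
  | succ n ih =>
    have hex : ∃ P, 1 ≤ E P := by
      by_contra! hc
      have : E = 0 := by
        ext P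
        have h1 := hc P
        have h2 := hE P
        simp only [Finsupp.coe_zero, Pi.zero_apply]
        omega
      rw [this] at hn
      simp [divDeg] at hn
      omega
    obtain ⟨P, hP⟩ := hex
    have h1 := ih (E - Finsupp.single P 1) (fun Q => by
      have := hE Q
      rw [Finsupp.sub_apply, Finsupp.single_apply]
      split_ifs with hPQ
      · subst hPQ; omega
      · omega) (by
      have := divDeg_add (E - Finsupp.single P 1) (Finsupp.single P 1)
      rw [sub_add_cancel, divDeg_single, hn] at this
      push_cast at this
      linarith)
    simpa using hadd _ n P h1

lemma RankGE.mono [Nonempty Γ] (hc : HasStarCharts Γ) {D : Divisor Γ} {m n : ℕ}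
    (h : RankGE Γ D n) (hmn : m ≤ n) : RankGE Γ D m := by
  intro E hE hd
  obtain ⟨P⟩ := ‹Nonempty Γ›
  have hF : Effective (Finsupp.single P ((n - m : ℕ) : ℤ)) := Effective.single P (by positivity)
  obtain ⟨B, hB, hBD⟩ := (equivEffective_iff hc).mp
    (h (E + Finsupp.single P ((n - m : ℕ) : ℤ)) (hE.add hF) (by
      rw [divDeg_add, divDeg_single, hd]; omega))
  refine (equivEffective_iff hc).mpr ⟨B + Finsupp.single P ((n - m : ℕ) : ℤ), hB.add hF, ?_⟩
  convert hBD using 1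
  abel

lemma divRank_bound [Nonempty Γ] (hc : HasStarCharts Γ) {D : Divisor Γ} {r : ℕ}
    (h : ¬ RankGE Γ D r) :
    ∀ n ∈ insert (-1) {n : ℤ | ∃ r : ℕ, n = (r : ℤ) ∧ RankGE Γ D r}, n ≤ (r : ℤ) - 1 := by
  rintro n (rfl | ⟨k, rfl, hk⟩)
  · omega
  · by_contra hcon
    exact h (hk.mono hc (by omega))

lemma divRank_lt [Nonempty Γ] (hc : HasStarCharts Γ) {D : Divisor Γ} {r : ℕ}
    (h : ¬ RankGE Γ D r) : divRank Γ D < r := by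
  have := csSup_le (insert_nonempty _ _) (divRank_bound hc h)
  rw [divRank]
  omega

lemma divRank_eq [Nonempty Γ] (hc : HasStarCharts Γ) {D : Divisor Γ} {r : ℕ}
    (h : RankGE Γ D r) (h' : ¬ RankGE Γ D (r + 1)) : divRank Γ D = r := by
  refine IsGreatest.csSup_eq ⟨Or.inr ⟨r, rfl, h⟩, fun n hn => ?_⟩
  have := divRank_bound hc h' n hn
  push_cast at this
  omega

/-- If removing a point destroys `RankGE D r`, then `RankGE D (r + 1)` fails. -/
lemma not_rankGE_succ {D : Divisor Γ} {r : ℕ} {P : Γ}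
    (h : ¬ RankGE Γ (D - Finsupp.single P 1) r) : ¬ RankGE Γ D (r + 1) := by
  intro hD
  refine h fun E hE hd => ?_
  have := hD (Finsupp.single P 1 + E) ((Effective.single P zero_le_one).add hE) (by
    rw [divDeg_add, divDeg_single, hd]; push_cast; ring)
  rwa [sub_sub]

end ChartedGraph

section Circle

variable {m : ℕ}

/-- The circle of circumference `m`. -/
abbrev Circ (m : ℕ) : Type := AddCircle (m : ℝ)

instance [h : Fact (3 ≤ m)] : Fact ((0 : ℝ) < (m : ℝ)) :=
  ⟨by have := h.out; exact_mod_cast (by omega : 0 < m)⟩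

lemma three_le_cast [h : Fact (3 ≤ m)] : (3 : ℝ) ≤ (m : ℝ) := by exact_mod_cast h.out

lemma norm_circ_coe [Fact (3 ≤ m)] {t : ℝ} (ht : |t| ≤ 1) : ‖((t : ℝ) : Circ m)‖ = |t| := by
  have := three_le_cast (m := m)
  have h0 : (0 : ℝ) < m := by linarith
  rw [AddCircle.norm_coe_eq_abs_iff _ h0.ne', abs_of_pos h0]
  linarith

lemma exists_eq_norm (z : Circ m) : z = ((‖z‖ : ℝ) : Circ m) ∨ z = -((‖z‖ : ℝ) : Circ m) := by
  induction z using QuotientAddGroup.induction_on with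
  | H x =>
    have h : ‖((x : ℝ) : Circ m)‖ = |x - round ((m : ℝ)⁻¹ * x) * m| := AddCircle.norm_eq _
    have hc : ((x - round ((m : ℝ)⁻¹ * x) * m : ℝ) : Circ m) = (x : Circ m) := by
      rw [AddCircle.coe_sub, sub_eq_self, AddCircle.coe_eq_zero_iff]
      exact ⟨round ((m : ℝ)⁻¹ * x), by simp⟩
    change (x : Circ m) = ((‖(x : Circ m)‖ : ℝ) : Circ m) ∨
      (x : Circ m) = -((‖(x : Circ m)‖ : ℝ) : Circ m)
    rw [h]
    rcases abs_choice (x - round ((m : ℝ)⁻¹ * x) * m) with h' | h' <;> rw [h']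
    · left; exact hc.symm
    · right; rw [AddCircle.coe_neg, neg_neg]; exact hc.symm

/-- The `k`-th integral point of the circle. -/
def ipt (m : ℕ) (k : ℤ) : Circ m := ((k : ℝ) : Circ m)

lemma norm_sub_ipt (t : ℝ) (k : ℤ) : |t - round t| ≤ ‖((t : ℝ) : Circ m) - ipt m k‖ := by
  rw [ipt, ← AddCircle.coe_sub, AddCircle.norm_eq]
  have := round_le t (k + round ((m : ℝ)⁻¹ * (t - k)) * m)
  push_cast at this
  rwa [← sub_sub] at this

lemma one_le_norm_ipt_sub {j k : ℤ} (h : ipt m j ≠ ipt m k) : 1 ≤ ‖ipt m j - ipt m k‖ := by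
  have h0 : ‖ipt m j - ipt m k‖ ≠ 0 := by rwa [norm_ne_zero_iff, sub_ne_zero]
  rw [ipt, ipt, ← AddCircle.coe_sub, AddCircle.norm_eq] at *
  have h1 : |(j : ℝ) - k - round ((m : ℝ)⁻¹ * ((j : ℝ) - k)) * m|
      = ((|j - k - round ((m : ℝ)⁻¹ * ((j : ℝ) - k)) * (m : ℤ)| : ℤ) : ℝ) := by
    push_cast; rfl
  rw [h1] at *
  have h2 := abs_nonneg (j - k - round ((m : ℝ)⁻¹ * ((j : ℝ) - k)) * (m : ℤ))
  have h3 : |j - k - round ((m : ℝ)⁻¹ * ((j : ℝ) - k)) * (m : ℤ)| ≠ 0 := by exact_mod_cast h0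
  exact_mod_cast (by omega : 1 ≤ |j - k - round ((m : ℝ)⁻¹ * ((j : ℝ) - k)) * (m : ℤ)|)

lemma exists_radius {x : Circ m} (hx : ∀ k, x ≠ ipt m k) :
    ∃ ρ > 0, ρ ≤ 1 / 2 ∧ ∀ k, ρ < ‖x - ipt m k‖ := by
  induction x using QuotientAddGroup.induction_on with
  | H t =>
    have h0 : 0 < |t - round t| := by
      rw [abs_pos, sub_ne_zero]
      intro h
      exact hx (round t) (congrArg (fun u : ℝ => (u : Circ m)) h)
    refine ⟨min (1 / 2) (|t - round t| / 2), by positivity, min_le_left _ _, fun k => ?_⟩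
    refine lt_of_le_of_lt (min_le_right _ _) (lt_of_lt_of_le (half_lt_self h0) ?_)
    exact norm_sub_ipt t k

/-- `g` is affine near `z` with outgoing slope `a` in the positive direction and `b` in the
negative direction. -/
def HasSlopes (g : Circ m → ℝ) (z : Circ m) (a b : ℤ) : Prop :=
  ∃ ε > (0 : ℝ), ∀ s ∈ Icc (0 : ℝ) ε,
    g (z + (s : ℝ)) = g z + a * s ∧ g (z - (s : ℝ)) = g z + b * s

lemma hasSlopes_iff {Γ : Type*} {f : Γ → ℝ} {ψ : Circ m → Γ} {z : Circ m} {a b : ℤ} :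
    HasSlopes (fun u => f (ψ u)) z a b ↔
      HasSlopeAlong f (fun t => ψ (z + (t : ℝ))) a ∧
      HasSlopeAlong f (fun t => ψ (z - (t : ℝ))) b := by
  constructor
  · rintro ⟨ε, hε, h⟩
    exact ⟨⟨ε, hε, fun t ht => by simpa using (h t ht).1⟩,
      ⟨ε, hε, fun t ht => by simpa using (h t ht).2⟩⟩
  · rintro ⟨⟨ε, hε, h⟩, ⟨ε', hε', h'⟩⟩
    refine ⟨min ε ε', lt_min hε hε', fun t ht => ⟨?_, ?_⟩⟩
    · simpa using h t ⟨ht.1, ht.2.trans (min_le_left _ _)⟩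
    · simpa using h' t ⟨ht.1, ht.2.trans (min_le_right _ _)⟩

lemma hasSlopes_const (c : ℝ) (z : Circ m) : HasSlopes (fun _ => c) z 0 0 :=
  ⟨1, one_pos, by simp⟩

lemma starDir_two : starDir 2 = ![1, -1] := by
  funext i
  fin_cases i
  · simp [starDir]
  · have : 2 * (Real.pi : ℂ) * Complex.I / 2 = Real.pi * Complex.I := by ring
    simp [starDir, this]

lemma starDir_four : starDir 4 = ![1, Complex.I, -1, -Complex.I] := by
  have h0 : 2 * (Real.pi : ℂ) * Complex.I / 4 = Real.pi / 2 * Complex.I := by ring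
  have hp : ∀ i : Fin 4, starDir 4 i = Complex.I ^ (i : ℕ) := by
    intro i
    rw [← Complex.exp_pi_div_two_mul_I, ← Complex.exp_nat_mul, starDir]
    congr 1
    push_cast
    ring
  funext i
  rw [hp]
  fin_cases i <;> simp [pow_succ]

lemma norm_coe_add [Fact (3 ≤ m)] {s t : ℝ} (hs : s ∈ Icc (0 : ℝ) (1 / 2))
    (ht : t ∈ Icc (0 : ℝ) (1 / 2)) : ‖((s : ℝ) : Circ m) + (t : ℝ)‖ = s + t := by
  rw [← AddCircle.coe_add, norm_circ_coe, abs_of_nonneg (by linarith [hs.1, ht.1])]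
  rw [abs_of_nonneg (by linarith [hs.1, ht.1])]
  linarith [hs.2, ht.2]

lemma norm_coe_sub [Fact (3 ≤ m)] {s t : ℝ} (hs : s ∈ Icc (0 : ℝ) (1 / 2))
    (ht : t ∈ Icc (0 : ℝ) (1 / 2)) : ‖((s : ℝ) : Circ m) - (t : ℝ)‖ = |s - t| := by
  rw [← AddCircle.coe_sub, norm_circ_coe]
  rw [abs_le]
  constructor <;> linarith [hs.1, ht.1, hs.2, ht.2]

variable {Γ : Type*} [MetricSpace Γ]

lemma exists_eq_add_or_sub (x z : Circ m) :
    z = x + ((‖x - z‖ : ℝ) : Circ m) ∨ z = x - ((‖x - z‖ : ℝ) : Circ m) := by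
  rw [norm_sub_rev]
  rcases exists_eq_norm (z - x) with h | h
  · left; rw [← h]; abel
  · right; rw [sub_eq_add_neg, ← h]; abel

/-- The chart along an isometrically embedded circle, at a point where it fills a
neighbourhood. -/
lemma isStarChart_two [Fact (3 ≤ m)] {ψ : Circ m → Γ} (hψ : ∀ u v, dist (ψ u) (ψ v) = ‖u - v‖)
    {x : Circ m} {ρ : ℝ} (h0 : 0 < ρ) (hρ : ρ ≤ 1 / 2)
    (hb : ∀ Q, dist (ψ x) Q ≤ ρ → ∃ z, Q = ψ z) :
    IsStarChart (ψ x) 2 ![fun t => ψ (x + (t : ℝ)), fun t => ψ (x - (t : ℝ))] ρ where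
  pos := h0
  dist_eq := by
    intro i j s hs t ht
    have hs' : s ∈ Icc (0 : ℝ) (1 / 2) := ⟨hs.1, hs.2.trans hρ⟩
    have ht' : t ∈ Icc (0 : ℝ) (1 / 2) := ⟨ht.1, ht.2.trans hρ⟩
    have e1 : ‖(s : ℂ) - t‖ = |s - t| := by
      rw [← Complex.ofReal_sub, Complex.norm_real, Real.norm_eq_abs]
    have e2 : ‖(s : ℂ) + t‖ = s + t := by
      rw [← Complex.ofReal_add, Complex.norm_real, Real.norm_eq_abs,
        abs_of_nonneg (add_nonneg hs.1 ht.1)]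
    have e4 : ∀ x : Circ m, ‖x - (s : ℝ) - (x + (t : ℝ))‖ = s + t := fun x => by
      rw [show x - (s : ℝ) - (x + (t : ℝ)) = -(((s : ℝ) : Circ m) + (t : ℝ)) by abel, norm_neg,
        norm_coe_add hs' ht']
    rw [starDir_two]
    fin_cases i <;> fin_cases j <;> simp [hψ]
    · rw [norm_coe_sub hs' ht', e1]
    · rw [norm_coe_add hs' ht', e2]
    · rw [e4 x, ← neg_add', norm_neg, e2]
    · rw [norm_coe_sub ht' hs', neg_add_eq_sub, ← Complex.ofReal_sub, Complex.norm_real,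
        Real.norm_eq_abs]
  zero := by intro i; fin_cases i <;> simp
  surj := by
    intro Q hQ
    obtain ⟨z, rfl⟩ := hb Q hQ
    rw [hψ]
    rcases exists_eq_add_or_sub x z with h | h
    · exact ⟨0, congrArg ψ h⟩
    · exact ⟨1, congrArg ψ h⟩

/-- The chart at the orthogonal crossing of two isometrically embedded circles. -/
lemma isStarChart_four [Fact (3 ≤ m)] {ψ χ : Circ m → Γ}
    (hψ : ∀ u v, dist (ψ u) (ψ v) = ‖u - v‖) (hχ : ∀ u v, dist (χ u) (χ v) = ‖u - v‖)
    {x y : Circ m} (hxy : ψ x = χ y)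
    (hc : ∀ u v, dist (ψ u) (χ v) = √(‖u - x‖ ^ 2 + ‖v - y‖ ^ 2)) {ρ : ℝ} (h0 : 0 < ρ)
    (hρ : ρ ≤ 1 / 2) (hb : ∀ Q, dist (ψ x) Q ≤ ρ → (∃ z, Q = ψ z) ∨ ∃ z, Q = χ z) :
    IsStarChart (ψ x) 4 ![fun t => ψ (x + (t : ℝ)), fun t => χ (y + (t : ℝ)),
      fun t => ψ (x - (t : ℝ)), fun t => χ (y - (t : ℝ))] ρ where
  pos := h0
  dist_eq := by
    intro i j s hs t ht
    have hs' : s ∈ Icc (0 : ℝ) (1 / 2) := ⟨hs.1, hs.2.trans hρ⟩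
    have ht' : t ∈ Icc (0 : ℝ) (1 / 2) := ⟨ht.1, ht.2.trans hρ⟩
    have hc' : ∀ u v, dist (χ v) (ψ u) = √(‖u - x‖ ^ 2 + ‖v - y‖ ^ 2) := fun u v => by
      rw [dist_comm, hc]
    have e1 : ∀ u v : ℂ, ‖u - v‖ = √((u.re - v.re) ^ 2 + (u.im - v.im) ^ 2) := by
      intro u v
      rw [← Complex.dist_eq, Complex.dist_eq_re_im]
    have e2 : ‖((s : ℝ) : Circ m)‖ = s := by
      rw [norm_circ_coe, abs_of_nonneg hs.1]; rw [abs_of_nonneg hs.1]; linarith [hs'.2]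
    have e3 : ‖((t : ℝ) : Circ m)‖ = t := by
      rw [norm_circ_coe, abs_of_nonneg ht.1]; rw [abs_of_nonneg ht.1]; linarith [ht'.2]
    have e4 : ∀ x : Circ m, ‖x - (s : ℝ) - (x + (t : ℝ))‖ = s + t := fun x => by
      rw [show x - (s : ℝ) - (x + (t : ℝ)) = -(((s : ℝ) : Circ m) + (t : ℝ)) by abel, norm_neg,
        norm_coe_add hs' ht']
    rw [starDir_four, e1]
    fin_cases i <;> fin_cases j <;>
      simp [hψ, hχ, hc, hc', e2, e3, norm_coe_sub hs' ht', norm_coe_add hs' ht',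
        Real.sqrt_sq_eq_abs]
    · exact (abs_of_nonneg (add_nonneg hs.1 ht.1)).symm
    · exact (abs_of_nonneg (add_nonneg hs.1 ht.1)).symm
    · rw [e4, ← neg_add', abs_neg, abs_of_nonneg (add_nonneg hs.1 ht.1)]
    · rw [norm_coe_sub ht' hs', neg_add_eq_sub]
    · rw [e4, ← neg_add', abs_neg, abs_of_nonneg (add_nonneg hs.1 ht.1)]
    · rw [norm_coe_sub ht' hs', neg_add_eq_sub]
  zero := by intro i; fin_cases i <;> simp [hxy]
  surj := by
    intro Q hQ
    rcases hb Q hQ with ⟨z, rfl⟩ | ⟨z, rfl⟩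
    · rw [hψ]
      rcases exists_eq_add_or_sub x z with h | h
      · exact ⟨0, congrArg ψ h⟩
      · exact ⟨2, congrArg ψ h⟩
    · rw [hxy, hχ]
      rcases exists_eq_add_or_sub y z with h | h
      · exact ⟨1, congrArg χ h⟩
      · exact ⟨3, congrArg χ h⟩

end Circle

/-- A circle of circumference `m` in a flat torus, together with the orthogonal circles through
its integral points. -/
abbrev Necklace (m : ℕ) : Type :=
  {q : WithLp 2 (Circ m × Circ m) // q.snd = 0 ∨ ∃ k : ℤ, q.fst = ipt m k}

namespace Necklace

variable {m : ℕ}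

/-- The central circle. -/
def hz (x : Circ m) : Necklace m := ⟨WithLp.toLp 2 (x, 0), Or.inl rfl⟩

/-- The circle attached at the `k`-th integral point. -/
def vt (k : ℤ) (y : Circ m) : Necklace m := ⟨WithLp.toLp 2 (ipt m k, y), Or.inr ⟨k, rfl⟩⟩

lemma dist_def (P Q : Necklace m) :
    dist P Q = √(‖P.1.fst - Q.1.fst‖ ^ 2 + ‖P.1.snd - Q.1.snd‖ ^ 2) := by
  rw [Subtype.dist_eq, WithLp.prod_dist_eq_of_L2, dist_eq_norm, dist_eq_norm]

@[simp] lemma hz_fst (x : Circ m) : (hz x).1.fst = x := rfl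
@[simp] lemma hz_snd (x : Circ m) : (hz x).1.snd = 0 := rfl
@[simp] lemma vt_fst (k : ℤ) (y : Circ m) : (vt k y).1.fst = ipt m k := rfl
@[simp] lemma vt_snd (k : ℤ) (y : Circ m) : (vt k y).1.snd = y := rfl

lemma ext {P Q : Necklace m} (h1 : P.1.fst = Q.1.fst) (h2 : P.1.snd = Q.1.snd) : P = Q := by
  apply Subtype.ext
  apply (WithLp.equiv 2 _).injective
  exact Prod.ext h1 h2

lemma hz_ipt (k : ℤ) : hz (ipt m k) = vt k 0 := ext rfl rfl

lemma vt_congr {j k : ℤ} (h : ipt m j = ipt m k) (y : Circ m) : vt j y = vt k y := ext h rfl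

lemma hz_injective : Function.Injective (hz (m := m)) := fun _ _ h =>
  congrArg (fun P : Necklace m => P.1.fst) h

lemma vt_eq_vt_iff {j k : ℤ} {y z : Circ m} : vt j y = vt k z ↔ ipt m j = ipt m k ∧ y = z :=
  ⟨fun h => ⟨congrArg (fun P : Necklace m => P.1.fst) h, congrArg (fun P : Necklace m => P.1.snd) h⟩,
    fun h => ext h.1 h.2⟩

lemma vt_eq_hz_iff {k : ℤ} {x y : Circ m} : vt k y = hz x ↔ ipt m k = x ∧ y = 0 :=
  ⟨fun h => ⟨congrArg (fun P : Necklace m => P.1.fst) h, congrArg (fun P : Necklace m => P.1.snd) h⟩,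
    fun h => ext h.1 h.2⟩

lemma dist_hz (u v : Circ m) : dist (hz u) (hz v) = ‖u - v‖ := by
  simp [dist_def]

lemma dist_vt (k : ℤ) (u v : Circ m) : dist (vt k u) (vt k v) = ‖u - v‖ := by
  simp [dist_def]

lemma dist_hz_vt (k : ℤ) (u v : Circ m) :
    dist (hz u) (vt k v) = √(‖u - ipt m k‖ ^ 2 + ‖v - 0‖ ^ 2) := by
  simp [dist_def]

lemma norm_fst_le (P Q : Necklace m) : ‖P.1.fst - Q.1.fst‖ ≤ dist P Q := by
  rw [dist_def]
  exact Real.le_sqrt_of_sq_le (le_add_of_nonneg_right (sq_nonneg _))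

lemma norm_snd_le (P Q : Necklace m) : ‖P.1.snd - Q.1.snd‖ ≤ dist P Q := by
  rw [dist_def]
  exact Real.le_sqrt_of_sq_le (le_add_of_nonneg_left (sq_nonneg _))

lemma eq_hz_or_vt (P : Necklace m) :
    P = hz P.1.fst ∨ ∃ k, P.1.fst = ipt m k ∧ P = vt k P.1.snd := by
  rcases P.2 with h | ⟨k, hk⟩
  · exact Or.inl (ext rfl h)
  · exact Or.inr ⟨k, hk, ext hk rfl⟩

/-- Every point is an interior point of an edge of the central circle, a crossing, or an
interior point of an attached circle. -/
@[elab_as_elim]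
lemma cases {p : Necklace m → Prop} (h1 : ∀ x, (∀ k, x ≠ ipt m k) → p (hz x))
    (h2 : ∀ k, p (hz (ipt m k))) (h3 : ∀ k y, y ≠ 0 → p (vt k y)) (P : Necklace m) : p P := by
  rcases eq_hz_or_vt P with h | ⟨k, -, h⟩
  · by_cases hx : ∃ k, P.1.fst = ipt m k
    · obtain ⟨k, hk⟩ := hx
      rw [h, hk]; exact h2 k
    · push Not at hx
      rw [h]; exact h1 _ hx
  · by_cases hy : P.1.snd = 0
    · rw [h, hy, ← hz_ipt]; exact h2 k
    · rw [h]; exact h3 k _ hy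

lemma continuous_hz : Continuous (hz (m := m)) :=
  (WithLp.prod_continuous_toLp 2 _ _ |>.comp (by fun_prop)).subtype_mk _

lemma continuous_vt (k : ℤ) : Continuous (vt (m := m) k) :=
  (WithLp.prod_continuous_toLp 2 _ _ |>.comp (by fun_prop)).subtype_mk _

lemma continuous_fst : Continuous (fun P : Necklace m => P.1.fst) :=
  (_root_.continuous_fst.comp (WithLp.prod_continuous_ofLp 2 _ _)).comp continuous_subtype_val

lemma continuous_snd : Continuous (fun P : Necklace m => P.1.snd) :=
  (_root_.continuous_snd.comp (WithLp.prod_continuous_ofLp 2 _ _)).comp continuous_subtype_val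

lemma ipt_emod (k : ℤ) : ipt m (k % m) = ipt m k := by
  rw [ipt, ipt, ← sub_eq_zero, ← AddCircle.coe_sub, AddCircle.coe_eq_zero_iff]
  refine ⟨-(k / m), ?_⟩
  have : ((k % m : ℤ) : ℝ) + m * ((k / m : ℤ) : ℝ) = k := by exact_mod_cast Int.emod_add_mul_ediv k m
  rw [zsmul_eq_mul]
  push_cast
  linarith

variable [Fact (3 ≤ m)]

lemma chart_hz {x : Circ m} (hx : ∀ k, x ≠ ipt m k) : ∃ ρ, IsStarChart (hz x) 2
    ![fun t => hz (x + (t : ℝ)), fun t => hz (x - (t : ℝ))] ρ := by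
  obtain ⟨ρ, h0, h1, h2⟩ := exists_radius hx
  refine ⟨ρ, isStarChart_two dist_hz h0 h1 fun Q hQ => ?_⟩
  rcases eq_hz_or_vt Q with h | ⟨k, hk, h⟩
  · exact ⟨_, h⟩
  · have h3 := (norm_fst_le (hz x) Q).trans hQ
    rw [hk, hz_fst] at h3
    exact absurd h3 (not_le.mpr (h2 k))

lemma chart_vt (k : ℤ) {y : Circ m} (hy : y ≠ 0) : ∃ ρ, IsStarChart (vt k y) 2
    ![fun t => vt k (y + (t : ℝ)), fun t => vt k (y - (t : ℝ))] ρ := by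
  have h0 : 0 < ‖y‖ := norm_pos_iff.mpr hy
  refine ⟨min (1 / 2) (‖y‖ / 2), isStarChart_two (dist_vt k) (by positivity) (min_le_left _ _)
    fun Q hQ => ?_⟩
  rcases eq_hz_or_vt Q with h | ⟨j, hj, h⟩
  · have h3 := (norm_snd_le (vt k y) Q).trans (hQ.trans (min_le_right _ _))
    rw [h, hz_snd, vt_snd, sub_zero] at h3
    linarith
  · by_cases hjk : ipt m k = ipt m j
    · exact ⟨_, h.trans (vt_congr hjk.symm _)⟩
    · have h3 := (norm_fst_le (vt k y) Q).trans (hQ.trans (min_le_left _ _))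
      rw [hj, vt_fst] at h3
      have := one_le_norm_ipt_sub hjk
      linarith

lemma chart_cross (k : ℤ) : ∃ ρ, IsStarChart (hz (ipt m k)) 4
    ![fun t => hz (ipt m k + (t : ℝ)), fun t => vt k (0 + (t : ℝ)),
      fun t => hz (ipt m k - (t : ℝ)), fun t => vt k (0 - (t : ℝ))] ρ := by
  refine ⟨1 / 2, isStarChart_four dist_hz (dist_vt k) (hz_ipt k) (dist_hz_vt k) (by norm_num)
    le_rfl fun Q hQ => ?_⟩
  rcases eq_hz_or_vt Q with h | ⟨j, hj, h⟩
  · exact Or.inl ⟨_, h⟩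
  · by_cases hjk : ipt m k = ipt m j
    · exact Or.inr ⟨_, h.trans (vt_congr hjk.symm _)⟩
    · have h3 := (norm_fst_le (hz (ipt m k)) Q).trans hQ
      rw [hj, hz_fst] at h3
      have := one_le_norm_ipt_sub hjk
      linarith

lemma hasStarCharts : HasStarCharts (Necklace m) := by
  intro P
  induction P using cases with
  | h1 x hx => exact ⟨_, _, chart_hz hx⟩
  | h2 k => exact ⟨_, _, chart_cross k⟩
  | h3 k y hy => exact ⟨_, _, chart_vt k hy⟩

lemma not_isVertex_hz {x : Circ m} (hx : ∀ k, x ≠ ipt m k) : ¬ IsVertex (Necklace m) (hz x) := by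
  obtain ⟨ρ, h⟩ := chart_hz hx
  simp [IsVertex, h.valence_eq]

lemma not_isVertex_vt (k : ℤ) {y : Circ m} (hy : y ≠ 0) : ¬ IsVertex (Necklace m) (vt k y) := by
  obtain ⟨ρ, h⟩ := chart_vt k hy
  simp [IsVertex, h.valence_eq]

lemma isVertex_cross (k : ℤ) : IsVertex (Necklace m) (hz (ipt m k)) := by
  obtain ⟨ρ, h⟩ := chart_cross (m := m) k
  simp [IsVertex, h.valence_eq]

lemma exists_fin_ipt (k : ℤ) : ∃ i : Fin m, ipt m k = ipt m ((i : ℕ) : ℤ) := by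
  have hm : 3 ≤ m := Fact.out
  have h0 := Int.emod_nonneg k (b := (m : ℤ)) (by omega)
  have h1 := Int.emod_lt_of_pos k (b := (m : ℤ)) (by omega)
  refine ⟨⟨(k % m).toNat, by omega⟩, ?_⟩
  rw [← ipt_emod]
  congr 1
  simp only
  omega

lemma ipt_inj {i j : ℕ} (hi : i < m) (hj : j < m) (h : ipt m i = ipt m j) : i = j := by
  have := (AddCircle.coe_eq_coe_iff_of_mem_Ico (p := (m : ℝ)) (a := 0) (x := (i : ℝ)) (y := (j : ℝ))
    ⟨by positivity, by simpa using hi⟩ ⟨by positivity, by simpa using hj⟩).mp (by simpa [ipt] using h)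
  exact_mod_cast this

instance : CompactSpace (Necklace m) := by
  have hc : IsCompact (range (hz (m := m)) ∪ ⋃ i : Fin m, range (vt (m := m) ((i : ℕ) : ℤ))) :=
    (isCompact_range continuous_hz).union
      (isCompact_iUnion fun i => isCompact_range (continuous_vt _))
  refine ⟨?_⟩
  convert hc
  symm
  rw [eq_univ_iff_forall]
  intro P
  rcases eq_hz_or_vt P with h | ⟨k, -, h⟩
  · exact Or.inl ⟨_, h.symm⟩
  · obtain ⟨i, hi⟩ := exists_fin_ipt (m := m) k
    exact Or.inr (mem_iUnion.mpr ⟨i, _, (h.trans (vt_congr hi _)).symm⟩)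

instance : ConnectedSpace (Necklace m) := by
  have h1 : IsPreconnected (range (hz (m := m))) := isPreconnected_range continuous_hz
  refine { isPreconnected_univ := ?_, toNonempty := ⟨hz 0⟩ }
  refine isPreconnected_of_forall (hz 0) fun P _ => ?_
  rcases eq_hz_or_vt P with h | ⟨k, -, h⟩
  · exact ⟨range hz, subset_univ _, ⟨_, rfl⟩, ⟨_, h.symm⟩, h1⟩
  · refine ⟨range hz ∪ range (vt k), subset_univ _, Or.inl ⟨_, rfl⟩, Or.inr ⟨_, h.symm⟩, ?_⟩
    exact h1.union (hz (ipt m k)) ⟨_, rfl⟩ ⟨0, (hz_ipt k).symm⟩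
      (isPreconnected_range (continuous_vt k))

lemma isMetricGraph : IsMetricGraph (Necklace m) := by
  refine ⟨inferInstance, inferInstance, fun P => ?_⟩
  obtain ⟨n, σ, ρ, h⟩ := hasStarCharts P
  exact ⟨n, h.one_le, h.hasStarNbhd⟩

end Necklace

lemma card_connectedComponents_of_partition {V ι : Type*} [TopologicalSpace V]
    (e : ι → Set V) (ho : ∀ i, IsOpen (e i)) (hp : ∀ i, IsPreconnected (e i))
    (hne : ∀ i, (e i).Nonempty) (hd : ∀ i j P, P ∈ e i → P ∈ e j → i = j)
    (hc : ∀ P, ∃ i, P ∈ e i) : Nat.card (ConnectedComponents V) = Nat.card ι := by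
  choose c hcmem using hc
  have hfib : ∀ i, c ⁻¹' {i} = e i := fun i => by
    ext P
    exact ⟨fun h => by simpa [← (show c P = i from h)] using hcmem P,
      fun h => hd _ _ P (hcmem P) h⟩
  have hcont : IsLocallyConstant c := by
    rw [IsLocallyConstant.iff_exists_open]
    intro P
    exact ⟨e (c P), ho _, hcmem P, fun Q hQ => hd _ _ Q (hcmem Q) hQ⟩
  let _ : TopologicalSpace ι := ⊥
  have : DiscreteTopology ι := ⟨rfl⟩
  have hcont' : Continuous c := hcont.continuous
  refine Nat.card_eq_of_bijective hcont'.connectedComponentsLift ⟨?_, fun i => ?_⟩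
  · intro x y
    induction x using Quotient.inductionOn with
    | h P =>
      induction y using Quotient.inductionOn with
      | h Q =>
        intro h
        have h' : c P = c Q := h
        apply Quotient.sound
        change connectedComponent P = connectedComponent Q
        have hQ : Q ∈ e (c P) := h' ▸ hcmem Q
        exact connectedComponent_eq ((hp _).subset_connectedComponent (hcmem P) hQ)
  · obtain ⟨P, hP⟩ := hne i
    exact ⟨(P : ConnectedComponents V), hd _ _ P (hcmem P) hP⟩

namespace Necklace

variable {m : ℕ}

lemma coe_ne_ipt {t : ℝ} {i : ℕ} (ht : t ∈ Ioo (i : ℝ) (i + 1)) (k : ℤ) :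
    ((t : ℝ) : Circ m) ≠ ipt m k := by
  intro h
  have h1 := norm_sub_ipt (m := m) t k
  rw [h, sub_self, norm_zero] at h1
  have h2 : t = round t := by
    have := abs_nonpos_iff.mp h1
    linarith
  rw [h2] at ht
  have h3 : (i : ℤ) < round t := by exact_mod_cast ht.1
  have h4 : round t < (i : ℤ) + 1 := by exact_mod_cast ht.2
  omega

lemma fst_eq_ipt {P : Necklace m} (h : P.1.snd ≠ 0) : ∃ k, P.1.fst = ipt m k := P.2.resolve_left h

variable [Fact (3 ≤ m)]

lemma ne_zero_iff_exists {y : Circ m} : y ≠ 0 ↔ ∃ t ∈ Ioo (0 : ℝ) m, ((t : ℝ) : Circ m) = y := by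
  constructor
  · intro hy
    obtain ⟨t, ht, rfl⟩ := AddCircle.eq_coe_Ico y
    refine ⟨t, ⟨lt_of_le_of_ne ht.1 ?_, ht.2⟩, rfl⟩
    rintro rfl
    exact hy (by simp)
  · rintro ⟨t, ht, rfl⟩ h
    rw [AddCircle.coe_eq_zero_iff_of_mem_Ico ⟨ht.1.le, ht.2⟩] at h
    exact ht.1.ne' h

lemma card_vertices : Nat.card {P : Necklace m // IsVertex (Necklace m) P} = m := by
  have : Function.Bijective (fun i : Fin m =>
      (⟨hz (ipt m ((i : ℕ) : ℤ)), isVertex_cross _⟩ :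
        {P : Necklace m // IsVertex (Necklace m) P})) := by
    constructor
    · intro i j h
      have h1 : hz (ipt m ((i : ℕ) : ℤ)) = hz (ipt m ((j : ℕ) : ℤ)) := congrArg Subtype.val h
      exact Fin.ext (ipt_inj i.2 j.2 (hz_injective h1))
    · rintro ⟨P, hP⟩
      induction P using cases with
      | h1 x hx => exact absurd hP (not_isVertex_hz hx)
      | h2 k =>
        obtain ⟨i, hi⟩ := exists_fin_ipt (m := m) k
        exact ⟨i, Subtype.ext (congrArg hz hi.symm)⟩
      | h3 k y hy => exact absurd hP (not_isVertex_vt k hy)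
  rw [← Nat.card_eq_of_bijective _ this, Nat.card_fin]

/-- The edges: open arcs of the central circle, and attached circles without their crossing. -/
def edge : Fin m ⊕ Fin m → Set {P : Necklace m // ¬ IsVertex (Necklace m) P}
  | Sum.inl i => {P | P.1.1.fst ∈ (fun t : ℝ => (t : Circ m)) '' Ioo ((i : ℕ) : ℝ) ((i : ℕ) + 1)}
  | Sum.inr i => {P | P.1.1.fst = ipt m ((i : ℕ) : ℤ)}

lemma snd_ne_zero {P : Necklace m} (hP : ¬ IsVertex (Necklace m) P) {k : ℤ}
    (h : P.1.fst = ipt m k) : P.1.snd ≠ 0 := by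
  intro h0
  refine hP ?_
  rw [show P = hz (ipt m k) from ext h h0]
  exact isVertex_cross k

lemma isOpen_edge (i : Fin m ⊕ Fin m) : IsOpen (edge i) := by
  have hval : Continuous (Subtype.val : {P : Necklace m // ¬ IsVertex (Necklace m) P} → Necklace m) :=
    continuous_subtype_val
  rcases i with i | i
  · exact (QuotientAddGroup.isOpenMap_coe _ isOpen_Ioo).preimage (continuous_fst.comp hval)
  · have : edge (Sum.inr i) = {P | ‖P.1.1.fst - ipt m ((i : ℕ) : ℤ)‖ < 1} ∩ {P | P.1.1.snd ≠ 0} := by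
      ext P
      constructor
      · intro h
        have h' : P.1.1.fst = ipt m ((i : ℕ) : ℤ) := h
        exact ⟨by simp [h'], snd_ne_zero P.2 h'⟩
      · rintro ⟨h1, h2⟩
        obtain ⟨k, hk⟩ := fst_eq_ipt h2
        change P.1.1.fst = ipt m ((i : ℕ) : ℤ)
        by_contra hc
        rw [hk] at hc
        have h3 : ‖P.1.1.fst - ipt m ((i : ℕ) : ℤ)‖ < 1 := h1
        rw [hk] at h3
        exact absurd h3 (not_lt.mpr (one_le_norm_ipt_sub hc))
    rw [this]
    have hf := continuous_fst.comp hval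
    have hs := continuous_snd.comp hval
    exact (isOpen_lt (hf.sub continuous_const).norm continuous_const).inter
      (isOpen_ne_fun hs continuous_const)

lemma isPreconnected_edge (i : Fin m ⊕ Fin m) : IsPreconnected (edge i) := by
  have hi : IsInducing (Subtype.val : {P : Necklace m // ¬ IsVertex _ P} → Necklace m) := ⟨rfl⟩
  rw [← hi.isPreconnected_image]
  rcases i with i | i
  · have : Subtype.val '' edge (Sum.inl i)
        = (fun t : ℝ => hz (t : Circ m)) '' Ioo ((i : ℕ) : ℝ) ((i : ℕ) + 1) := by
      ext P
      constructor
      · rintro ⟨P, ⟨t, ht, hP⟩, rfl⟩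
        refine ⟨t, ht, ?_⟩
        rcases P.1.2 with h | ⟨k, hk⟩
        · exact ext hP h.symm
        · exact absurd (hP.trans hk) (coe_ne_ipt ht k)
      · rintro ⟨t, ht, rfl⟩
        exact ⟨⟨_, not_isVertex_hz (coe_ne_ipt ht)⟩, ⟨t, ht, rfl⟩, rfl⟩
    rw [this]
    exact isPreconnected_Ioo.image _
      (continuous_hz.comp (AddCircle.continuous_mk' _)).continuousOn
  · have : Subtype.val '' edge (Sum.inr i)
        = (fun t : ℝ => vt ((i : ℕ) : ℤ) (t : Circ m)) '' Ioo (0 : ℝ) m := by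
      ext P
      constructor
      · rintro ⟨P, hP, rfl⟩
        obtain ⟨t, ht, h⟩ := ne_zero_iff_exists.mp (snd_ne_zero P.2 hP)
        exact ⟨t, ht, ext (Eq.symm hP) h⟩
      · rintro ⟨t, ht, rfl⟩
        exact ⟨⟨_, not_isVertex_vt _ (ne_zero_iff_exists.mpr ⟨t, ht, rfl⟩)⟩, rfl, rfl⟩
    rw [this]
    exact isPreconnected_Ioo.image _
      ((continuous_vt _).comp (AddCircle.continuous_mk' _)).continuousOn

lemma card_edges :
    Nat.card (ConnectedComponents {P : Necklace m // ¬ IsVertex (Necklace m) P}) = 2 * m := by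
  have hm : (0 : ℝ) < m := Fact.out
  rw [card_connectedComponents_of_partition edge isOpen_edge isPreconnected_edge]
  · simp [two_mul]
  · rintro (i | i)
    · have ht : ((i : ℕ) : ℝ) + 1 / 2 ∈ Ioo ((i : ℕ) : ℝ) ((i : ℕ) + 1) := by
        constructor <;> linarith
      exact ⟨⟨_, not_isVertex_hz (coe_ne_ipt ht)⟩, _, ht, rfl⟩
    · exact ⟨⟨_, not_isVertex_vt ((i : ℕ) : ℤ) (ne_zero_iff_exists.mpr
        ⟨(m : ℝ) / 2, ⟨by linarith, by linarith⟩, rfl⟩)⟩, rfl⟩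
  · rintro (i | i) (j | j) P h h'
    · obtain ⟨t, ht, h1⟩ := h
      obtain ⟨u, hu, h2⟩ := h'
      have hmem : ∀ (k : Fin m) (t : ℝ), t ∈ Ioo ((k : ℕ) : ℝ) ((k : ℕ) + 1) →
          t ∈ Ico (0 : ℝ) (0 + m) := by
        intro k t ht
        have h1 : ((k : ℕ) : ℝ) + 1 ≤ m := by exact_mod_cast k.2
        have h2 : (0 : ℝ) ≤ ((k : ℕ) : ℝ) := by positivity
        exact ⟨h2.trans ht.1.le, by rw [zero_add]; exact ht.2.trans_le h1⟩
      have h3 := (AddCircle.coe_eq_coe_iff_of_mem_Ico (p := (m : ℝ)) (hmem i t ht)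
        (hmem j u hu)).mp (h1.trans h2.symm)
      subst h3
      have h4 : ((i : ℕ) : ℝ) < (j : ℕ) + 1 := ht.1.trans hu.2
      have h5 : ((j : ℕ) : ℝ) < (i : ℕ) + 1 := hu.1.trans ht.2
      have h6 : (i : ℕ) < (j : ℕ) + 1 := by exact_mod_cast h4
      have h7 : (j : ℕ) < (i : ℕ) + 1 := by exact_mod_cast h5
      rw [Fin.ext (by omega : (i : ℕ) = j)]
    · obtain ⟨t, ht, h1⟩ := h
      exact absurd (h1.trans h') (coe_ne_ipt ht _)
    · obtain ⟨t, ht, h1⟩ := h'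
      exact absurd (h1.trans h) (coe_ne_ipt ht _)
    · rw [Fin.ext (ipt_inj i.2 j.2 (Eq.trans (Eq.symm h) h'))]
  · rintro ⟨P, hP⟩
    induction P using cases with
    | h1 x hx =>
      obtain ⟨t, ht, rfl⟩ := AddCircle.eq_coe_Ico x
      have h0 : 0 ≤ ⌊t⌋ := Int.floor_nonneg.mpr ht.1
      have h1 : ⌊t⌋ < m := Int.floor_lt.mpr (by exact_mod_cast ht.2)
      have hcast : ((⌊t⌋.toNat : ℕ) : ℝ) = (⌊t⌋ : ℝ) := by
        have : ((⌊t⌋.toNat : ℕ) : ℤ) = ⌊t⌋ := Int.toNat_of_nonneg h0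
        exact_mod_cast congrArg (Int.cast : ℤ → ℝ) this
      refine ⟨Sum.inl ⟨⌊t⌋.toNat, by omega⟩, t, ⟨?_, ?_⟩, rfl⟩
      · refine lt_of_le_of_ne (by simpa only [hcast] using Int.floor_le t) fun h => hx ⌊t⌋ ?_
        simp only [hcast] at h
        rw [ipt, h]
      · simpa only [hcast] using Int.lt_floor_add_one t
    | h2 k => exact absurd (isVertex_cross k) hP
    | h3 k y hy =>
      obtain ⟨i, hi⟩ := exists_fin_ipt (m := m) k
      exact ⟨Sum.inr i, hi⟩

lemma genus_eq : graphGenus (Necklace m) = m + 1 := by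
  rw [graphGenus, card_edges, card_vertices]
  push_cast
  ring

end Necklace

namespace Necklace

variable {m : ℕ} [Fact (3 ≤ m)]

lemma hasOrderAt_hz {F : Necklace m → ℝ} {x : Circ m} (hx : ∀ k, x ≠ ipt m k) {a b : ℤ}
    (h : HasSlopes (fun u => F (hz u)) x a b) : HasOrderAt (Necklace m) F (hz x) (a + b) := by
  obtain ⟨ρ, hρ⟩ := chart_hz hx
  obtain ⟨h1, h2⟩ := hasSlopes_iff.mp h
  simpa using hρ.hasOrderAt (f := F) (s := ![a, b]) fun i => by fin_cases i <;> assumption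

lemma hasOrderAt_vt {F : Necklace m → ℝ} {k : ℤ} {y : Circ m} (hy : y ≠ 0) {a b : ℤ}
    (h : HasSlopes (fun u => F (vt k u)) y a b) : HasOrderAt (Necklace m) F (vt k y) (a + b) := by
  obtain ⟨ρ, hρ⟩ := chart_vt k hy
  obtain ⟨h1, h2⟩ := hasSlopes_iff.mp h
  simpa using hρ.hasOrderAt (f := F) (s := ![a, b]) fun i => by fin_cases i <;> assumption

lemma hasOrderAt_cross {F : Necklace m → ℝ} {k : ℤ} {a b c d : ℤ}
    (h : HasSlopes (fun u => F (hz u)) (ipt m k) a b)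
    (h' : HasSlopes (fun u => F (vt k u)) 0 c d) :
    HasOrderAt (Necklace m) F (hz (ipt m k)) (a + b + (c + d)) := by
  obtain ⟨ρ, hρ⟩ := chart_cross (m := m) k
  obtain ⟨h1, h2⟩ := hasSlopes_iff.mp h
  obtain ⟨h3, h4⟩ := hasSlopes_iff.mp h'
  have := hρ.hasOrderAt (f := F) (s := ![a, c, b, d]) fun i => by fin_cases i <;> assumption
  convert this using 1
  simp [Fin.sum_univ_four]
  ring

lemma exists_slopes_hz {F : Necklace m → ℝ} {x : Circ m} (hx : ∀ k, x ≠ ipt m k) {n : ℤ}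
    (h : HasOrderAt (Necklace m) F (hz x) n) :
    ∃ a b, HasSlopes (fun u => F (hz u)) x a b ∧ n = a + b := by
  obtain ⟨ρ, hρ⟩ := chart_hz hx
  obtain ⟨s, hs, hn⟩ := hρ.exists_slopes h
  exact ⟨s 0, s 1, hasSlopes_iff.mpr ⟨hs 0, hs 1⟩, by simpa using hn⟩

lemma exists_slopes_vt {F : Necklace m → ℝ} {k : ℤ} {y : Circ m} (hy : y ≠ 0) {n : ℤ}
    (h : HasOrderAt (Necklace m) F (vt k y) n) :
    ∃ a b, HasSlopes (fun u => F (vt k u)) y a b ∧ n = a + b := by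
  obtain ⟨ρ, hρ⟩ := chart_vt k hy
  obtain ⟨s, hs, hn⟩ := hρ.exists_slopes h
  exact ⟨s 0, s 1, hasSlopes_iff.mpr ⟨hs 0, hs 1⟩, by simpa using hn⟩

lemma exists_slopes_cross {F : Necklace m → ℝ} {k : ℤ} {n : ℤ}
    (h : HasOrderAt (Necklace m) F (hz (ipt m k)) n) :
    ∃ a b c d, HasSlopes (fun u => F (hz u)) (ipt m k) a b ∧
      HasSlopes (fun u => F (vt k u)) 0 c d ∧ n = a + b + (c + d) := by
  obtain ⟨ρ, hρ⟩ := chart_cross (m := m) k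
  obtain ⟨s, hs, hn⟩ := hρ.exists_slopes h
  refine ⟨s 0, s 2, s 1, s 3, hasSlopes_iff.mpr ⟨hs 0, hs 2⟩, hasSlopes_iff.mpr ⟨hs 1, hs 3⟩, ?_⟩
  rw [hn, Fin.sum_univ_four]
  ring

lemma isPrincipalDivisor_of_slopes {F : Necklace m → ℝ} {A : Divisor (Necklace m)}
    {α : Circ m → ℤ} {β : ℤ → Circ m → ℤ}
    (hα : ∀ x, ∃ a b, HasSlopes (fun u => F (hz u)) x a b ∧ a + b = α x)
    (hβ : ∀ k y, ∃ a b, HasSlopes (fun u => F (vt k u)) y a b ∧ a + b = β k y)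
    (h1 : ∀ x, (∀ k, x ≠ ipt m k) → A (hz x) = α x)
    (h2 : ∀ k, A (hz (ipt m k)) = α (ipt m k) + β k 0)
    (h3 : ∀ k y, y ≠ 0 → A (vt k y) = β k y) : IsPrincipalDivisor A := by
  refine ⟨F, isRational_of_slopes F fun P => ?_, fun P => ?_⟩
  · induction P using cases with
    | h1 x hx =>
      obtain ⟨a, b, h, -⟩ := hα x
      obtain ⟨ρ, hρ⟩ := chart_hz hx
      obtain ⟨h1, h2⟩ := hasSlopes_iff.mp h
      exact ⟨_, _, ρ, hρ, fun i => by fin_cases i <;> exact ⟨_, by assumption⟩⟩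
    | h2 k =>
      obtain ⟨a, b, h, -⟩ := hα (ipt m k)
      obtain ⟨c, d, h', -⟩ := hβ k 0
      obtain ⟨ρ, hρ⟩ := chart_cross (m := m) k
      obtain ⟨h1, h2⟩ := hasSlopes_iff.mp h
      obtain ⟨h3, h4⟩ := hasSlopes_iff.mp h'
      refine ⟨_, _, ρ, hρ, fun i => ?_⟩
      fin_cases i
      exacts [⟨_, h1⟩, ⟨_, h3⟩, ⟨_, h2⟩, ⟨_, h4⟩]
    | h3 k y hy =>
      obtain ⟨a, b, h, -⟩ := hβ k y
      obtain ⟨ρ, hρ⟩ := chart_vt k hy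
      obtain ⟨h1, h2⟩ := hasSlopes_iff.mp h
      refine ⟨_, _, ρ, hρ, fun i => ?_⟩
      fin_cases i
      exacts [⟨_, h1⟩, ⟨_, h2⟩]
  · induction P using cases with
    | h1 x hx =>
      obtain ⟨a, b, h, hab⟩ := hα x
      rw [h1 x hx, ← hab]
      exact hasOrderAt_hz hx h
    | h2 k =>
      obtain ⟨a, b, h, hab⟩ := hα (ipt m k)
      obtain ⟨c, d, h', hcd⟩ := hβ k 0
      rw [h2, ← hab, ← hcd]
      exact hasOrderAt_cross h h'
    | h3 k y hy =>
      obtain ⟨a, b, h, hab⟩ := hβ k y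
      rw [h3 k y hy, ← hab]
      exact hasOrderAt_vt hy h

end Necklace

section Green

variable {m : ℕ} [Fact (3 ≤ m)]

/-- The Green function of the circle, up to sign and an additive constant. -/
noncomputable def green (m : ℕ) [Fact (3 ≤ m)] (z : Circ m) : ℝ :=
  AddCircle.liftIco (m : ℝ) 0 (fun t => t / 2 - t ^ 2 / (2 * m)) z

lemma green_coe {t : ℝ} (ht : t ∈ Icc (0 : ℝ) m) : green m (t : Circ m) = t / 2 - t ^ 2 / (2 * m) := by
  have h3 := three_le_cast (m := m)
  rcases eq_or_lt_of_le ht.2 with h | h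
  · rw [h, AddCircle.coe_period, ← AddCircle.coe_zero, green,
      AddCircle.liftIco_coe_apply ⟨le_rfl, by linarith⟩]
    field_simp
    ring
  · exact AddCircle.liftIco_coe_apply ⟨ht.1, by linarith⟩

lemma green_expansion (w : Circ m) : ∃ τ τ' : ℝ, ∃ ε > (0 : ℝ), (τ : Circ m) = w ∧
    (τ' : Circ m) = w ∧ (τ' - τ = if w = 0 then (m : ℝ) else 0) ∧ ∀ s ∈ Icc (0 : ℝ) ε,
      green m (w + (s : ℝ)) = green m w + (s / 2 - s * τ / m - s ^ 2 / (2 * m)) ∧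
      green m (w - (s : ℝ)) = green m w + (-s / 2 + s * τ' / m - s ^ 2 / (2 * m)) := by
  have h3 := three_le_cast (m := m)
  have key : ∀ τ τ' : ℝ, 0 ≤ τ → τ < m → 0 < τ' → τ' ≤ m → (τ : Circ m) = w → (τ' : Circ m) = w →
      ∃ ε > (0 : ℝ), ∀ s ∈ Icc (0 : ℝ) ε,
      green m (w + (s : ℝ)) = green m w + (s / 2 - s * τ / m - s ^ 2 / (2 * m)) ∧
      green m (w - (s : ℝ)) = green m w + (-s / 2 + s * τ' / m - s ^ 2 / (2 * m)) := by
    intro τ τ' h1 h2 h3 h4 h5 h6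
    refine ⟨min (m - τ) τ', lt_min (by linarith) h3, fun s hs => ⟨?_, ?_⟩⟩
    · have := hs.2.trans (min_le_left _ _)
      rw [← h5, ← AddCircle.coe_add, green_coe ⟨by linarith [hs.1], by linarith⟩,
        green_coe ⟨h1, h2.le⟩]
      field_simp
      ring
    · have := hs.2.trans (min_le_right _ _)
      rw [← h6, ← AddCircle.coe_sub, green_coe ⟨by linarith [hs.1], by linarith [hs.1]⟩,
        green_coe ⟨h3.le, h4⟩]
      field_simp
      ring
  by_cases hw : w = 0
  · obtain ⟨ε, hε, h⟩ := key 0 m le_rfl (by linarith) (by linarith) le_rfl (by simp [hw])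
      (by simp [hw, AddCircle.coe_period])
    exact ⟨0, m, ε, hε, by simp [hw], by simp [hw, AddCircle.coe_period], by simp [hw], h⟩
  · obtain ⟨t, ht, rfl⟩ := Necklace.ne_zero_iff_exists.mp hw
    obtain ⟨ε, hε, h⟩ := key t t ht.1.le ht.2 ht.1 ht.2.le rfl rfl
    exact ⟨t, t, ε, hε, rfl, rfl, by simp [hw], h⟩

/-- A rational function on the circle with divisor `0 + (x + y) - x - y`. -/
noncomputable def bump (x y : Circ m) (z : Circ m) : ℝ :=
  green m z + green m (z - (x + y)) - green m (z - x) - green m (z - y)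

open Classical in
lemma bump_hasSlopes (x y z : Circ m) : ∃ a b, HasSlopes (bump x y) z a b ∧
    a + b = (if z = 0 then 1 else 0) + (if z = x + y then 1 else 0)
      - (if z = x then 1 else 0) - (if z = y then 1 else 0) := by
  have h3 := three_le_cast (m := m)
  obtain ⟨t₁, u₁, ε₁, h₁, ht₁, hu₁, hd₁, hs₁⟩ := green_expansion z
  obtain ⟨t₂, u₂, ε₂, h₂, ht₂, hu₂, hd₂, hs₂⟩ := green_expansion (z - (x + y))
  obtain ⟨t₃, u₃, ε₃, h₃, ht₃, hu₃, hd₃, hs₃⟩ := green_expansion (z - x)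
  obtain ⟨t₄, u₄, ε₄, h₄, ht₄, hu₄, hd₄, hs₄⟩ := green_expansion (z - y)
  have ht : ((t₁ + t₂ - t₃ - t₄ : ℝ) : Circ m) = 0 := by
    rw [AddCircle.coe_sub, AddCircle.coe_sub, AddCircle.coe_add, ht₁, ht₂, ht₃, ht₄]
    abel
  have hu : ((u₁ + u₂ - u₃ - u₄ : ℝ) : Circ m) = 0 := by
    rw [AddCircle.coe_sub, AddCircle.coe_sub, AddCircle.coe_add, hu₁, hu₂, hu₃, hu₄]
    abel
  obtain ⟨a, ha⟩ := (AddCircle.coe_eq_zero_iff _).mp ht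
  obtain ⟨b, hb⟩ := (AddCircle.coe_eq_zero_iff _).mp hu
  rw [zsmul_eq_mul] at ha hb
  refine ⟨-a, b, ⟨min (min ε₁ ε₂) (min ε₃ ε₄), by positivity, fun s hs => ?_⟩, ?_⟩
  · obtain ⟨hs0, hs⟩ := hs
    rw [le_min_iff, le_min_iff, le_min_iff] at hs
    obtain ⟨p₁, q₁⟩ := hs₁ s ⟨hs0, hs.1.1⟩
    obtain ⟨p₂, q₂⟩ := hs₂ s ⟨hs0, hs.1.2⟩
    obtain ⟨p₃, q₃⟩ := hs₃ s ⟨hs0, hs.2.1⟩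
    obtain ⟨p₄, q₄⟩ := hs₄ s ⟨hs0, hs.2.2⟩
    have ha' : (a : ℝ) = (t₁ + t₂ - t₃ - t₄) / m := by rw [← ha]; field_simp
    have hb' : (b : ℝ) = (u₁ + u₂ - u₃ - u₄) / m := by rw [← hb]; field_simp
    have e1 : ∀ w : Circ m, z + (s : ℝ) - w = z - w + (s : ℝ) := fun w => by abel
    have e2 : ∀ w : Circ m, z - (s : ℝ) - w = z - w - (s : ℝ) := fun w => by abel
    simp only [bump, e1, e2, p₁, p₂, p₃, p₄, q₁, q₂, q₃, q₄]
    push_cast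
    rw [ha', hb']
    constructor <;> ring
  · have : ((-a + b : ℤ) : ℝ) * m = (((if z = 0 then 1 else 0) + (if z = x + y then 1 else 0)
      - (if z = x then 1 else 0) - (if z = y then 1 else 0) : ℤ) : ℝ) * m := by
      have e : ((-a + b : ℤ) : ℝ) * m
          = (u₁ - t₁) + (u₂ - t₂) - (u₃ - t₃) - (u₄ - t₄) := by
        push_cast
        linear_combination hb - ha
      rw [e, hd₁, hd₂, hd₃, hd₄]
      simp only [sub_eq_zero]
      push_cast
      simp only [add_mul, sub_mul, ite_mul, one_mul, zero_mul]
    exact_mod_cast mul_right_cancel₀ (by linarith) this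

end Green

namespace Necklace

variable {m : ℕ} [Fact (3 ≤ m)]

lemma principal_hz (x y : Circ m) : (Finsupp.single (hz 0) 1 + Finsupp.single (hz (x + y)) 1
    - Finsupp.single (hz x) 1 - Finsupp.single (hz y) 1 : Divisor (Necklace m))
      ∈ principalDivisors (hasStarCharts (m := m)) := by
  classical
  have hA : ∀ z w : Circ m, (Finsupp.single (hz z) 1 : Divisor (Necklace m)) (hz w)
      = if w = z then 1 else 0 := fun z w => by
    rw [Finsupp.single_apply]
    simp only [hz_injective.eq_iff, eq_comm]
  have hB : ∀ (z : Circ m) k y, y ≠ 0 → (Finsupp.single (hz z) 1 : Divisor (Necklace m)) (vt k y)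
      = 0 := fun z k y hy => by
    rw [Finsupp.single_apply, if_neg]
    exact fun h => hy (vt_eq_hz_iff.mp h.symm).2
  refine isPrincipalDivisor_of_slopes (F := fun P => bump x y P.1.fst)
    (β := fun _ _ => 0) (bump_hasSlopes x y)
    (fun k w => ⟨0, 0, hasSlopes_const (bump x y (ipt m k)) _, rfl⟩) ?_ ?_ ?_
  · intro w _
    simp only [Finsupp.sub_apply, Finsupp.add_apply, hA]
  · intro k
    simp only [Finsupp.sub_apply, Finsupp.add_apply, hA, add_zero]
  · intro k w hw
    simp only [Finsupp.sub_apply, Finsupp.add_apply, hB _ k w hw]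
    rfl

lemma principal_vt (k : ℤ) (x y : Circ m) :
    (Finsupp.single (vt k 0) 1 + Finsupp.single (vt k (x + y)) 1
      - Finsupp.single (vt k x) 1 - Finsupp.single (vt k y) 1 : Divisor (Necklace m))
      ∈ principalDivisors (hasStarCharts (m := m)) := by
  classical
  have hA : ∀ (z : Circ m) j w, (Finsupp.single (vt k z) 1 : Divisor (Necklace m)) (vt j w)
      = if ipt m j = ipt m k then (if w = z then 1 else 0) else 0 := fun z j w => by
    rw [Finsupp.single_apply]
    simp only [vt_eq_vt_iff, ← ite_and, eq_comm]
  have hB : ∀ (z w : Circ m), (∀ j, w ≠ ipt m j) →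
      (Finsupp.single (vt k z) 1 : Divisor (Necklace m)) (hz w) = 0 := fun z w hw => by
    rw [Finsupp.single_apply, if_neg]
    exact fun h => hw k (vt_eq_hz_iff.mp h).1.symm
  refine isPrincipalDivisor_of_slopes (α := fun _ => 0)
    (F := fun P => if P.1.fst = ipt m k then bump x y P.1.snd else bump x y 0)
    (β := fun j w => if ipt m j = ipt m k then (if w = 0 then 1 else 0)
      + (if w = x + y then 1 else 0) - (if w = x then 1 else 0) - (if w = y then 1 else 0) else 0)
    (fun z => ⟨0, 0, ?_, rfl⟩) (fun j w => ?_) ?_ ?_ ?_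
  · convert hasSlopes_const (bump x y 0) z using 1
    funext u
    exact ite_self _
  · by_cases h : ipt m j = ipt m k
    · simpa [h] using bump_hasSlopes x y w
    · exact ⟨0, 0, by simpa [h] using hasSlopes_const _ _, by simp [h]⟩
  · intro w hw
    simp only [Finsupp.sub_apply, Finsupp.add_apply, hB _ w hw]
    rfl
  · intro j
    simp only [Finsupp.sub_apply, Finsupp.add_apply, hA, hz_ipt]
    split_ifs <;> simp
  · intro j w hw
    simp only [Finsupp.sub_apply, Finsupp.add_apply, hA]
    split_ifs <;> simp

end Necklace

namespace Necklace

variable {m : ℕ}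

/-- Twice the first `r` crossings plus the midpoint of the first arc of the central circle. -/
noncomputable def cliffordDivisor (m r : ℕ) : Divisor (Necklace m) :=
  (∑ i ∈ Finset.range r, Finsupp.single (hz (ipt m (i : ℕ))) 2)
    + Finsupp.single (hz ((1 / 2 : ℝ) : Circ m)) 1

lemma effective_cliffordDivisor (r : ℕ) : Effective (cliffordDivisor m r) :=
  (Effective.sum fun _ _ => Effective.single _ zero_le_two).add (Effective.single _ zero_le_one)

lemma divDeg_cliffordDivisor (r : ℕ) : divDeg (cliffordDivisor m r) = 2 * r + 1 := by
  simp [cliffordDivisor, divDeg_add, divDeg_sum, divDeg_single, mul_comm]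

variable [Fact (3 ≤ m)]

lemma exists_equiv_cliffordDivisor (r : ℕ) : ∃ s : Circ m,
    Finsupp.single (hz s) 1 + (2 * r : ℤ) • Finsupp.single (hz 0) 1 - cliffordDivisor m r
      ∈ principalDivisors (hasStarCharts (m := m)) := by
  induction r with
  | zero => exact ⟨((1 / 2 : ℝ) : Circ m), by simp [cliffordDivisor, zero_mem]⟩
  | succ r ih =>
    obtain ⟨s, hs⟩ := ih
    set p := ipt m r
    refine ⟨s + p + p, ?_⟩
    convert add_mem hs (add_mem (principal_hz s p) (principal_hz (s + p) p)) using 1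
    have h2 : (Finsupp.single (hz p) 2 : Divisor (Necklace m)) = (2 : ℤ) • Finsupp.single (hz p) 1 := by
      simp
    rw [cliffordDivisor, cliffordDivisor, Finset.sum_range_succ, h2]
    push_cast
    module

lemma exists_equiv_neg (n : ℕ) (E : Divisor (Necklace m)) (hE : Effective E) (hn : divDeg E = n) :
    ∃ (B : Divisor (Necklace m)) (x : Circ m) (c : ℤ), Effective B ∧ c ≤ 2 * n ∧
      B + Finsupp.single (hz x) 1 - (c + 1) • Finsupp.single (hz 0) 1 + E
        ∈ principalDivisors (hasStarCharts (m := m)) := by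
  refine Effective.induction (p := fun E n => ∃ (B : Divisor (Necklace m)) (x : Circ m) (c : ℤ),
    Effective B ∧ c ≤ 2 * n ∧ B + Finsupp.single (hz x) 1 - (c + 1) • Finsupp.single (hz 0) 1 + E
      ∈ principalDivisors (hasStarCharts (m := m))) ?_ ?_ n E hE hn
  · exact ⟨0, 0, 0, fun _ => le_rfl, by simp, by simp [zero_mem]⟩
  · rintro E n P ⟨B, x, c, hB, hc, h⟩
    rcases eq_hz_or_vt P with hP | ⟨k, -, hP⟩
    · set z := P.1.fst
      rw [hP]
      refine ⟨B, x - z, c + 1, hB, by push_cast; linarith, ?_⟩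
      convert sub_mem h (principal_hz (x - z) z) using 1
      rw [sub_add_cancel]
      module
    · set y := P.1.snd
      set p := ipt m k with hp
      rw [hP]
      refine ⟨B + Finsupp.single (vt k (-y)) 1, x - p - p, c + 2,
        hB.add (Effective.single _ zero_le_one), by push_cast; linarith, ?_⟩
      convert sub_mem h (add_mem (principal_vt k y (-y))
        (add_mem (principal_hz (x - p) p) (principal_hz (x - p - p) p))) using 1
      rw [add_neg_cancel, ← hz_ipt, ← hp, sub_add_cancel, sub_add_cancel]
      module

lemma rankGE_cliffordDivisor (r : ℕ) : RankGE (Necklace m) (cliffordDivisor m r) r := by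
  intro E hE hd
  obtain ⟨s, hs⟩ := exists_equiv_cliffordDivisor (m := m) r
  obtain ⟨B, x, c, hB, hc, h⟩ := exists_equiv_neg r E hE hd
  refine (equivEffective_iff hasStarCharts).mpr
    ⟨B + Finsupp.single (hz (x + s)) 1 + Finsupp.single (hz 0) (2 * r - c),
      (hB.add (Effective.single _ zero_le_one)).add (Effective.single _ (by linarith)), ?_⟩
  convert add_mem (add_mem hs h) (principal_hz x s) using 1
  rw [← Finsupp.smul_single_one (hz 0) (2 * r - c : ℤ)]
  module

end Necklace

section Convexity

/-- A piecewise affine function which is locally convex lies above its tangent at the left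
endpoint. -/
lemma tangent_le_of_locally_convex {F : ℝ → ℝ} {a b R : ℝ} (hc : Continuous F)
    (hR : ∃ ε > (0 : ℝ), ∀ s ∈ Icc (0 : ℝ) ε, F (a + s) = F a + R * s)
    (hF : ∀ t ∈ Ioo a b, ∃ p q : ℝ, 0 ≤ p + q ∧ ∃ ε > (0 : ℝ), ∀ s ∈ Icc (0 : ℝ) ε,
      F (t + s) = F t + p * s ∧ F (t - s) = F t + q * s) {x : ℝ} (hx : x ∈ Icc a b) :
    F a + R * (x - a) ≤ F x := by
  by_contra! hlt
  have hax : a < x := lt_of_le_of_ne hx.1 (by rintro rfl; simp at hlt)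
  have hxa : 0 < x - a := sub_pos.mpr hax
  set κ := (F x - F a) / (x - a) with hκ
  have hκR : κ < R := by rw [hκ, div_lt_iff₀ hxa]; linarith
  set H : ℝ → ℝ := fun t => F t - κ * (t - a) with hH
  have hHc : Continuous H := by fun_prop
  have hHx : H x = H a := by
    simp only [hH, hκ]
    field_simp
    ring
  obtain ⟨t₁, ht₁, hmax⟩ := isCompact_Icc.exists_isMaxOn (nonempty_Icc.mpr hax.le) hHc.continuousOn
  obtain ⟨t, ⟨ht, htM⟩, hgr⟩ := (isCompact_Icc.inter_right
    (isClosed_eq hHc continuous_const : IsClosed {t | H t = H t₁})).exists_isGreatest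
      ⟨t₁, ht₁, rfl⟩
  have hM : H a < H t₁ := by
    obtain ⟨ε, hε, h⟩ := hR
    have hs : 0 < min ε (x - a) := lt_min hε hxa
    refine lt_of_lt_of_le ?_
      (hmax (show a + min ε (x - a) ∈ Icc a x from ⟨by linarith, by linarith [min_le_right ε (x - a)]⟩))
    simp only [hH, h _ ⟨hs.le, min_le_left _ _⟩]
    nlinarith
  have hta : a < t := lt_of_le_of_ne ht.1 (by rintro rfl; exact hM.ne htM)
  have htx : t < x := lt_of_le_of_ne ht.2 (by rintro rfl; exact hM.ne (hHx.symm.trans htM))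
  obtain ⟨p, q, hpq, ε, hε, h⟩ := hF t ⟨hta, htx.trans_le hx.2⟩
  set s := min ε (min (t - a) (x - t)) with hs
  have hs0 : 0 < s := lt_min hε (lt_min (by linarith) (by linarith))
  have hs1 : s ≤ t - a := (min_le_right _ _).trans (min_le_left _ _)
  have hs2 : s ≤ x - t := (min_le_right _ _).trans (min_le_right _ _)
  obtain ⟨h1, h2⟩ := h s ⟨hs0.le, min_le_left _ _⟩
  have m1 : t + s ∈ Icc a x := ⟨by linarith, by linarith⟩
  have m2 : t - s ∈ Icc a x := ⟨by linarith, by linarith⟩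
  have h3 : H (t + s) ≤ H t₁ := hmax m1
  have h4 : H (t - s) ≤ H t₁ := hmax m2
  have h5 : H (t + s) = H t₁ + (p - κ) * s := by rw [← htM]; simp only [hH, h1]; ring
  have h6 : H (t - s) = H t₁ + (q + κ) * s := by rw [← htM]; simp only [hH, h2]; ring
  have h7 : p - κ ≤ 0 := nonpos_of_mul_nonpos_left (by linarith) hs0
  have h8 : q + κ ≤ 0 := nonpos_of_mul_nonpos_left (by linarith) hs0
  have h9 : p - κ = 0 := by linarith
  have := hgr ⟨m1, by rw [mem_ofPred_eq, h5, h9]; ring⟩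
  linarith

lemma tangent_le_of_locally_convex' {F : ℝ → ℝ} {a b L : ℝ} (hc : Continuous F)
    (hL : ∃ ε > (0 : ℝ), ∀ s ∈ Icc (0 : ℝ) ε, F (b - s) = F b + L * s)
    (hF : ∀ t ∈ Ioo a b, ∃ p q : ℝ, 0 ≤ p + q ∧ ∃ ε > (0 : ℝ), ∀ s ∈ Icc (0 : ℝ) ε,
      F (t + s) = F t + p * s ∧ F (t - s) = F t + q * s) {x : ℝ} (hx : x ∈ Icc a b) :
    F b + L * (b - x) ≤ F x := by
  have := tangent_le_of_locally_convex (F := fun t => F (-t)) (a := -b) (b := -a) (R := L)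
    (hc.comp continuous_neg) ?_ ?_ (x := -x) ⟨neg_le_neg hx.2, neg_le_neg hx.1⟩
  · simpa [neg_add_eq_sub] using this
  · obtain ⟨ε, hε, h⟩ := hL
    exact ⟨ε, hε, fun s hs => by simpa [neg_add_eq_sub, sub_eq_add_neg, add_comm] using h s hs⟩
  · intro t ht
    obtain ⟨p, q, hpq, ε, hε, h⟩ := hF (-t) ⟨by linarith [ht.2], by linarith [ht.1]⟩
    refine ⟨q, p, by linarith, ε, hε, fun s hs => ?_⟩
    obtain ⟨h1, h2⟩ := h s hs
    exact ⟨by rw [← h2]; congr 1; ring, by rw [← h1]; congr 1; ring⟩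

variable {m : ℕ} [Fact (3 ≤ m)]

lemma slopes_bound {g : Circ m → ℝ} (hg : Continuous g) {z : Circ m} {R L : ℤ}
    (hz : HasSlopes g z R L)
    (h : ∀ w, w ≠ z → ∃ p q, HasSlopes g w p q ∧ 0 ≤ p + q) :
    R ≤ 0 ∧ L ≤ 0 ∧ ∀ d ∈ Ioo (0 : ℝ) m, ∀ p q, HasSlopes g (z + (d : ℝ)) p q →
      q + R ≤ 0 ∧ p + L ≤ 0 ∧ R * d + p * (m - d) ≤ 0 ∧ L * (m - d) + q * d ≤ 0 := by
  have h3 := three_le_cast (m := m)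
  set F : ℝ → ℝ := fun t => g (z + (t : ℝ)) with hF
  have hFc : Continuous F := hg.comp (continuous_const.add (AddCircle.continuous_mk' _))
  have hF0 : F 0 = g z := by simp [hF]
  have hFm : F m = g z := by simp [hF, AddCircle.coe_period]
  have hsl : ∀ {t : ℝ} {p q : ℤ}, HasSlopes g (z + (t : ℝ)) p q → ∃ ε > (0 : ℝ),
      ∀ s ∈ Icc (0 : ℝ) ε, F (t + s) = F t + p * s ∧ F (t - s) = F t + q * s := by
    rintro t p q ⟨ε, hε, h⟩
    refine ⟨ε, hε, fun s hs => ?_⟩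
    simp only [hF, AddCircle.coe_add, AddCircle.coe_sub, ← add_assoc, ← add_sub_assoc]
    exact h s hs
  have hconv : ∀ t ∈ Ioo (0 : ℝ) m, ∃ p q : ℝ, 0 ≤ p + q ∧ ∃ ε > (0 : ℝ), ∀ s ∈ Icc (0 : ℝ) ε,
      F (t + s) = F t + p * s ∧ F (t - s) = F t + q * s := by
    intro t ht
    obtain ⟨p, q, hpq, h0⟩ := h (z + (t : ℝ)) (by
      rw [Ne, add_eq_left]
      exact Necklace.ne_zero_iff_exists.mpr ⟨t, ht, rfl⟩)
    exact ⟨p, q, by exact_mod_cast h0, hsl hpq⟩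
  have hR : ∃ ε > (0 : ℝ), ∀ s ∈ Icc (0 : ℝ) ε, F (0 + s) = F 0 + R * s := by
    obtain ⟨ε, hε, h⟩ := hsl (t := 0) (by simpa using hz)
    exact ⟨ε, hε, fun s hs => (h s hs).1⟩
  have hL : ∃ ε > (0 : ℝ), ∀ s ∈ Icc (0 : ℝ) ε, F (m - s) = F m + L * s := by
    obtain ⟨ε, hε, h⟩ := hsl (t := m) (by simpa [AddCircle.coe_period] using hz)
    exact ⟨ε, hε, fun s hs => (h s hs).2⟩
  have tR : ∀ x ∈ Icc (0 : ℝ) m, F 0 + R * (x - 0) ≤ F x := fun x hx =>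
    tangent_le_of_locally_convex hFc hR hconv hx
  have tL : ∀ x ∈ Icc (0 : ℝ) m, F m + L * (m - x) ≤ F x := fun x hx =>
    tangent_le_of_locally_convex' hFc hL hconv hx
  have e1 := tR m ⟨by linarith, le_rfl⟩
  have e2 := tL 0 ⟨le_rfl, by linarith⟩
  rw [hF0, hFm] at e1 e2
  refine ⟨?_, ?_, fun d hd p q hpq => ?_⟩
  · have : (R : ℝ) ≤ 0 := by nlinarith
    exact_mod_cast this
  · have : (L : ℝ) ≤ 0 := by nlinarith
    exact_mod_cast this
  · obtain ⟨ε, hε, hs⟩ := hsl hpq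
    have e3 := tR d ⟨hd.1.le, hd.2.le⟩
    have e4 := tL d ⟨hd.1.le, hd.2.le⟩
    have e5 := tangent_le_of_locally_convex (b := m) hFc ⟨ε, hε, fun s h => (hs s h).1⟩
      (fun t ht => hconv t ⟨hd.1.trans ht.1, ht.2⟩) ⟨hd.2.le, le_rfl⟩
    have e6 := tangent_le_of_locally_convex' (a := 0) hFc ⟨ε, hε, fun s h => (hs s h).2⟩
      (fun t ht => hconv t ⟨ht.1, ht.2.trans hd.2⟩) ⟨le_rfl, hd.1.le⟩
    rw [hF0] at e3 e6
    rw [hFm] at e4 e5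
    have h1 : ((q + R : ℤ) : ℝ) * d ≤ 0 := by push_cast; linarith
    have h2 : ((p + L : ℤ) : ℝ) * (m - d) ≤ 0 := by push_cast; linarith
    refine ⟨?_, ?_, by linarith, by linarith⟩
    · exact_mod_cast nonpos_of_mul_nonpos_left h1 hd.1
    · exact_mod_cast nonpos_of_mul_nonpos_left h2 (sub_pos.mpr hd.2)

/-- A nonconstant function on the circle which is convex away from one point has order at most
`-2` there. -/
lemma slopes_le_neg_two {g : Circ m → ℝ} (hg : Continuous g) {z : Circ m} {R L : ℤ}
    (hz : HasSlopes g z R L)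
    (h : ∀ w, w ≠ z → ∃ p q, HasSlopes g w p q ∧ 0 ≤ p + q) {e : Circ m} (he : e ≠ z)
    (hpos : ∃ p q, HasSlopes g e p q ∧ 0 < p + q) : R + L ≤ -2 := by
  obtain ⟨d, hd, hde⟩ := Necklace.ne_zero_iff_exists.mp (sub_ne_zero.mpr he)
  obtain ⟨p, q, hpq, h0⟩ := hpos
  rw [show e = z + (d : ℝ) by rw [hde]; abel] at hpq
  obtain ⟨h1, h2, h'⟩ := slopes_bound hg hz h
  obtain ⟨h3, h4, h5, h6⟩ := h' d hd p q hpq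
  have hd0 := hd.1
  have hdm : 0 < (m : ℝ) - d := sub_pos.mpr hd.2
  have hR : R ≠ 0 := by
    rintro rfl
    have : ((p : ℤ) : ℝ) * (m - d) ≤ 0 := by simpa using h5
    have : p ≤ 0 := by exact_mod_cast nonpos_of_mul_nonpos_left this hdm
    omega
  have hL : L ≠ 0 := by
    rintro rfl
    have : ((q : ℤ) : ℝ) * d ≤ 0 := by simpa using h6
    have : q ≤ 0 := by exact_mod_cast nonpos_of_mul_nonpos_left this hd0
    omega
  omega

/-- Two chips at an integral point of the circle cannot be moved to the next one. -/
lemma not_slopes_double {g : Circ m → ℝ} (hg : Continuous g) {z : Circ m}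
    (h : ∀ w, w ≠ z → ∃ p q, HasSlopes g w p q ∧ 0 ≤ p + q)
    (hz : ∃ R L, HasSlopes g z R L ∧ -2 ≤ R + L)
    (hpos : ∃ p q, HasSlopes g (z + ((1 : ℝ) : Circ m)) p q ∧ 2 ≤ p + q) : False := by
  have hm := three_le_cast (m := m)
  obtain ⟨R, L, hz, h0⟩ := hz
  obtain ⟨p, q, hpq, h2⟩ := hpos
  have h1 : R + L ≤ -2 := by
    refine slopes_le_neg_two hg hz h (e := z + ((1 : ℝ) : Circ m)) ?_ ⟨p, q, hpq, by omega⟩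
    rw [Ne, add_eq_left]
    exact Necklace.ne_zero_iff_exists.mpr ⟨1, ⟨one_pos, by linarith⟩, rfl⟩
  obtain ⟨-, -, h'⟩ := slopes_bound hg hz h
  obtain ⟨h3, h4, h5, h6⟩ := h' 1 ⟨one_pos, by linarith⟩ p q hpq
  obtain rfl : p = -L := by omega
  obtain rfl : q = -R := by omega
  have hRL : (R : ℝ) = -2 - L := by exact_mod_cast (by omega : R = -2 - L)
  push_cast at h5 h6
  rw [hRL] at h5 h6
  have h7 : ((L : ℤ) : ℝ) < 0 := by
    by_contra! hL
    nlinarith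
  have h8 : L ≤ -1 := by
    have : L < 0 := by exact_mod_cast h7
    omega
  have h9 : ((L : ℤ) : ℝ) ≤ -1 := by exact_mod_cast h8
  nlinarith

end Convexity

namespace Necklace

variable {m : ℕ}

open Classical in
lemma cliffordDivisor_hz (r : ℕ) (z : Circ m) : cliffordDivisor m r (hz z)
    = (∑ i ∈ Finset.range r, if ipt m (i : ℕ) = z then 2 else 0)
      + if ((1 / 2 : ℝ) : Circ m) = z then 1 else 0 := by
  simp only [cliffordDivisor, Finsupp.add_apply, Finsupp.finsetSum_apply, Finsupp.single_apply,
    hz_injective.eq_iff]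

lemma cliffordDivisor_vt (r : ℕ) (k : ℤ) {y : Circ m} (hy : y ≠ 0) :
    cliffordDivisor m r (vt k y) = 0 := by
  classical
  have h : ∀ z, hz z ≠ vt k y := fun z hz' => hy (vt_eq_hz_iff.mp hz'.symm).2
  simp [cliffordDivisor, h]

/-- The midpoints of the attached circles indexed by `J`. -/
noncomputable def midpoints (m : ℕ) (J : Finset ℕ) : Divisor (Necklace m) :=
  ∑ k ∈ J, Finsupp.single (vt (k : ℕ) ((1 / 2 : ℝ) : Circ m)) 1

lemma effective_midpoints (J : Finset ℕ) : Effective (midpoints m J) :=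
  Effective.sum fun _ _ => Effective.single _ zero_le_one

lemma divDeg_midpoints (J : Finset ℕ) : divDeg (midpoints m J) = J.card := by
  simp [midpoints, divDeg_sum, divDeg_single]

lemma one_le_midpoints {J : Finset ℕ} {k : ℕ} (hk : k ∈ J) :
    1 ≤ midpoints m J (vt (k : ℕ) ((1 / 2 : ℝ) : Circ m)) := by
  rw [midpoints, Finsupp.finsetSum_apply]
  refine le_trans ?_ (Finset.single_le_sum
    (f := fun i : ℕ => (Finsupp.single (vt (i : ℤ) ((1 / 2 : ℝ) : Circ m)) (1 : ℤ))
      (vt (k : ℤ) ((1 / 2 : ℝ) : Circ m))) (fun i _ => Effective.single _ zero_le_one _) hk)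
  simp

lemma cliffordDivisor_hz_of_ne (r : ℕ) {z : Circ m} (h1 : z ≠ ((1 / 2 : ℝ) : Circ m))
    (h2 : ∀ k, z ≠ ipt m k) : cliffordDivisor m r (hz z) = 0 := by
  classical
  rw [cliffordDivisor_hz, if_neg h1.symm, Finset.sum_eq_zero, zero_add]
  exact fun i _ => if_neg (h2 _).symm

variable [Fact (3 ≤ m)]

lemma coe_half_ne_zero : ((1 / 2 : ℝ) : Circ m) ≠ 0 := by
  have hm := three_le_cast (m := m)
  exact ne_zero_iff_exists.mpr ⟨1 / 2, ⟨by norm_num, by linarith⟩, rfl⟩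

lemma coe_half_ne_ipt (k : ℤ) : ((1 / 2 : ℝ) : Circ m) ≠ ipt m k := by
  have hm : 3 ≤ m := Fact.out
  exact coe_ne_ipt (i := (⟨0, by omega⟩ : Fin m)) (by constructor <;> norm_num) k

lemma exists_central_slopes {A : Divisor (Necklace m)} (hA : ∀ k y, y ≠ 0 → A (vt k y) ≤ 0)
    (h : EquivEffective (Necklace m) A) : ∃ g : Circ m → ℝ, Continuous g ∧
      ∀ z, ∃ p q, HasSlopes g z p q ∧ -A (hz z) ≤ p + q ∧
        ∀ k, z = ipt m k → (∃ y, y ≠ 0 ∧ A (vt k y) < 0) → 2 - A (hz z) ≤ p + q := by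
  obtain ⟨B, hB, f, hf, hord⟩ := h
  refine ⟨fun z => f (hz z), hf.1.comp continuous_hz, fun z => ?_⟩
  by_cases hz' : ∃ k, z = ipt m k
  · obtain ⟨k, rfl⟩ := hz'
    obtain ⟨a, b, c, d, h1, h2, h3⟩ := exists_slopes_cross (hord (hz (ipt m k)))
    have hB0 := hB (hz (ipt m k))
    have hconv : ∀ w, w ≠ 0 → ∃ p q, HasSlopes (fun u => f (vt k u)) w p q ∧ 0 ≤ p + q := by
      intro w hw
      obtain ⟨p, q, hpq, hs⟩ := exists_slopes_vt hw (hord (vt k w))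
      have h4 := hB (vt k w)
      have h5 := hA k w hw
      exact ⟨p, q, hpq, by omega⟩
    refine ⟨a, b, h1, ?_, ?_⟩
    · obtain ⟨h4, h5, -⟩ := slopes_bound (hf.1.comp (continuous_vt k)) h2 hconv
      omega
    · rintro j hj ⟨y, hy, hy'⟩
      rw [vt_congr hj.symm] at hy'
      have h4 := slopes_le_neg_two (hf.1.comp (continuous_vt k)) h2 hconv hy (by
        obtain ⟨p, q, hpq, hs⟩ := exists_slopes_vt hy (hord (vt k y))
        have h4 := hB (vt k y)
        exact ⟨p, q, hpq, by omega⟩)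
      omega
  · push Not at hz'
    obtain ⟨a, b, h1, h2⟩ := exists_slopes_hz hz' (hord (hz z))
    have hB0 := hB (hz z)
    exact ⟨a, b, h1, by omega, fun k hk => absurd hk (hz' k)⟩

lemma cliffordDivisor_ipt {r k : ℕ} (hr : r ≤ m) (hk : k < m) :
    cliffordDivisor m r (hz (ipt m (k : ℕ))) = if k < r then 2 else 0 := by
  classical
  rw [cliffordDivisor_hz, if_neg (coe_half_ne_ipt _), add_zero,
    Finset.sum_congr rfl (g := fun i => if i = k then 2 else 0), Finset.sum_ite_eq']
  · simp
  · intro i hi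
    have hi' : i < m := (Finset.mem_range.mp hi).trans_le hr
    by_cases h : i = k
    · simp [h]
    · rw [if_neg h, if_neg fun h' => h (ipt_inj hi' hk h')]

lemma cliffordDivisor_half (r : ℕ) :
    cliffordDivisor m r (hz ((1 / 2 : ℝ) : Circ m)) = 1 := by
  classical
  rw [cliffordDivisor_hz, if_pos rfl, Finset.sum_eq_zero, zero_add]
  exact fun i _ => if_neg (coe_half_ne_ipt _).symm

lemma midpoints_hz (J : Finset ℕ) (z : Circ m) : midpoints m J (hz z) = 0 := by
  classical
  rw [midpoints, Finsupp.finsetSum_apply, Finset.sum_eq_zero]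
  intro i _
  rw [Finsupp.single_apply, if_neg]
  exact fun h => coe_half_ne_zero (vt_eq_hz_iff.mp h).2

open Classical in
lemma exists_slopes_sub_midpoints {r : ℕ} (hr : r ≤ m) {P : Necklace m} {J : Finset ℕ}
    (h : EquivEffective (Necklace m) (cliffordDivisor m r - Finsupp.single P 1 - midpoints m J)) :
    ∃ g : Circ m → ℝ, Continuous g ∧
      (∃ p q, HasSlopes g ((1 / 2 : ℝ) : Circ m) p q ∧
        Finsupp.single P 1 (hz ((1 / 2 : ℝ) : Circ m)) - (1 : ℤ) ≤ p + q) ∧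
      (∀ z, z ≠ ((1 / 2 : ℝ) : Circ m) → (∀ k, z ≠ ipt m k) →
        ∃ p q, HasSlopes g z p q ∧ Finsupp.single P 1 (hz z) ≤ p + q) ∧
      ∀ k < m, ∃ p q, HasSlopes g (ipt m (k : ℕ)) p q ∧
        Finsupp.single P 1 (hz (ipt m (k : ℕ))) - (if k < r then 2 else 0)
          + (if k ∈ J ∨ ∃ y, y ≠ 0 ∧ P = vt (k : ℕ) y then 2 else 0) ≤ p + q := by
  have hP := Effective.single P (zero_le_one (α := ℤ))
  have hJ := effective_midpoints (m := m) J
  obtain ⟨g, hg, hs⟩ := exists_central_slopes (fun k y hy => by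
    rw [Finsupp.sub_apply, Finsupp.sub_apply, cliffordDivisor_vt r k hy]
    have h1 := hP (vt k y)
    have h2 := hJ (vt k y)
    omega) h
  simp only [Finsupp.sub_apply, midpoints_hz, sub_zero] at hs
  refine ⟨g, hg, ?_, fun z h1 h2 => ?_, fun k hk => ?_⟩
  · obtain ⟨p, q, hpq, h1, -⟩ := hs ((1 / 2 : ℝ) : Circ m)
    rw [cliffordDivisor_half] at h1
    exact ⟨p, q, hpq, by omega⟩
  · obtain ⟨p, q, hpq, h3, -⟩ := hs z
    rw [cliffordDivisor_hz_of_ne r h1 h2] at h3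
    exact ⟨p, q, hpq, by omega⟩
  · obtain ⟨p, q, hpq, h1, h2⟩ := hs (ipt m (k : ℕ))
    rw [cliffordDivisor_ipt hr hk] at h1 h2
    refine ⟨p, q, hpq, ?_⟩
    split_ifs with h3 h4 h4
    · have h5 := h2 k rfl ?_
      · rw [if_pos h3] at h5; omega
      · rcases h4 with h4 | ⟨y, hy, rfl⟩
        · refine ⟨_, coe_half_ne_zero, ?_⟩
          rw [cliffordDivisor_vt r k coe_half_ne_zero]
          have h6 := one_le_midpoints (m := m) h4
          have h7 := hP (vt (k : ℕ) ((1 / 2 : ℝ) : Circ m))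
          omega
        · refine ⟨y, hy, ?_⟩
          rw [cliffordDivisor_vt r k hy, Finsupp.single_eq_same]
          have h6 := hJ (vt (k : ℕ) y)
          omega
    · rw [if_pos h3] at h1; omega
    · have h5 := h2 k rfl ?_
      · rw [if_neg h3] at h5; omega
      · rcases h4 with h4 | ⟨y, hy, rfl⟩
        · refine ⟨_, coe_half_ne_zero, ?_⟩
          rw [cliffordDivisor_vt r k coe_half_ne_zero]
          have h6 := one_le_midpoints (m := m) h4
          have h7 := hP (vt (k : ℕ) ((1 / 2 : ℝ) : Circ m))
          omega
        · refine ⟨y, hy, ?_⟩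
          rw [cliffordDivisor_vt r k hy, Finsupp.single_eq_same]
          have h6 := hJ (vt (k : ℕ) y)
          omega
    · rw [if_neg h3] at h1; omega

lemma not_rankGE_sub_single {r : ℕ} (h1 : 1 ≤ r) (hr : r + 2 ≤ m) (P : Necklace m) :
    ¬ RankGE (Necklace m) (cliffordDivisor m r - Finsupp.single P 1) r := by
  classical
  intro hrank
  have hE : ∀ J : Finset ℕ, J.card = r →
      EquivEffective (Necklace m) (cliffordDivisor m r - Finsupp.single P 1 - midpoints m J) :=
    fun J hJ => hrank _ (effective_midpoints J) (by rw [divDeg_midpoints, hJ])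
  have hP := Effective.single P (zero_le_one (α := ℤ))
  have htri : ∀ z : Circ m, (∃ k < m, z = ipt m (k : ℕ)) ∨ ∀ k, z ≠ ipt m k := by
    intro z
    by_cases h : ∃ k, z = ipt m k
    · obtain ⟨k, rfl⟩ := h
      obtain ⟨i, hi⟩ := exists_fin_ipt (m := m) k
      exact Or.inl ⟨i, i.2, hi⟩
    · exact Or.inr (not_exists.mp h)
  have hPcases : (∃ x, P = hz x) ∨ ∃ i < m, ∃ y, y ≠ 0 ∧ P = vt (i : ℕ) y := by
    induction P using cases with
    | h1 x _ => exact Or.inl ⟨x, rfl⟩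
    | h2 k => exact Or.inl ⟨_, rfl⟩
    | h3 k y hy =>
      obtain ⟨i, hi⟩ := exists_fin_ipt (m := m) k
      exact Or.inr ⟨i, i.2, y, hy, vt_congr hi y⟩
  rcases hPcases with ⟨x, hPx⟩ | ⟨i, him, y, hy, hPy⟩
  · have hPs : ∀ z, Finsupp.single P (1 : ℤ) (hz z) = if x = z then 1 else 0 := fun z => by
      rw [hPx, Finsupp.single_apply]
      simp only [hz_injective.eq_iff]
    by_cases hx : x = ((1 / 2 : ℝ) : Circ m)
    · obtain ⟨g, hg, ⟨p, q, hpq, ho⟩, hz', hk⟩ := exists_slopes_sub_midpoints (by omega)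
        (hE ((Finset.range (r + 1)).erase (r - 1)) (by
          rw [Finset.card_erase_of_mem (Finset.mem_range.mpr (by omega)), Finset.card_range]
          omega))
      rw [hPs, if_pos hx] at ho
      refine not_slopes_double hg (z := ipt m ((r - 1 : ℕ) : ℤ)) (fun w hw => ?_) ?_ ?_
      · rcases htri w with ⟨k, hkm, rfl⟩ | h
        · obtain ⟨a, b, hab, h⟩ := hk k hkm
          have h2 := hP (hz (ipt m (k : ℕ)))
          refine ⟨a, b, hab, ?_⟩
          have hkr : k ≠ r - 1 := by rintro rfl; exact hw rfl
          split_ifs at h with h3 h4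
          · omega
          · exact absurd (Or.inl (by simp; omega)) h4
          · omega
          · omega
        · by_cases hw' : w = ((1 / 2 : ℝ) : Circ m)
          · exact ⟨p, q, hw' ▸ hpq, by omega⟩
          · obtain ⟨a, b, hab, h3⟩ := hz' w hw' h
            exact ⟨a, b, hab, (hP _).trans h3⟩
      · obtain ⟨a, b, hab, h⟩ := hk (r - 1) (by omega)
        have h2 := hP (hz (ipt m ((r - 1 : ℕ) : ℤ)))
        refine ⟨a, b, hab, ?_⟩
        split_ifs at h <;> omega
      · obtain ⟨a, b, hab, h⟩ := hk r (by omega)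
        have h2 := hP (hz (ipt m (r : ℕ)))
        rw [if_neg (lt_irrefl r), if_pos (Or.inl (by simp; omega))] at h
        refine ⟨a, b, ?_, by omega⟩
        convert hab using 1
        rw [ipt, ipt, ← AddCircle.coe_add]
        congr 1
        push_cast [h1]
        ring
    · obtain ⟨g, hg, ⟨p, q, hpq, ho⟩, hz', hk⟩ := exists_slopes_sub_midpoints (by omega)
        (hE (Finset.range r) (Finset.card_range r))
      rw [hPs, if_neg hx] at ho
      have key : ∀ w, w ≠ ((1 / 2 : ℝ) : Circ m) → ∃ p q, HasSlopes g w p q ∧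
          (if x = w then 1 else 0) ≤ p + q := by
        intro w hw
        rcases htri w with ⟨k, hkm, rfl⟩ | h
        · obtain ⟨a, b, hab, h⟩ := hk k hkm
          refine ⟨a, b, hab, ?_⟩
          rw [← hPs]
          split_ifs at h with h3 h4
          · omega
          · exact absurd (Or.inl (Finset.mem_range.mpr h3)) h4
          · omega
          · omega
        · obtain ⟨a, b, hab, h3⟩ := hz' w hw h
          exact ⟨a, b, hab, by rw [← hPs]; exact h3⟩
      have := slopes_le_neg_two hg hpq (fun w hw => by
        obtain ⟨a, b, hab, h⟩ := key w hw
        exact ⟨a, b, hab, by split_ifs at h <;> omega⟩) hx (by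
        obtain ⟨a, b, hab, h⟩ := key x hx
        exact ⟨a, b, hab, by rw [if_pos rfl] at h; omega⟩)
      omega
  · obtain ⟨J, s, hJ, hsm, hsr, hs, hJr⟩ : ∃ (J : Finset ℕ) (s : ℕ), J.card = r ∧ s < m ∧
        ¬ s < r ∧ (s ∈ J ∨ s = i) ∧ ∀ k < r, k ∈ J ∨ k = i := by
      by_cases hir : i < r
      · refine ⟨(Finset.range (r + 1)).erase i, r, ?_, by omega, lt_irrefl r, Or.inl ?_, ?_⟩
        · rw [Finset.card_erase_of_mem (Finset.mem_range.mpr (by omega)), Finset.card_range]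
          omega
        · simp; omega
        · intro k hk
          simp; omega
      · exact ⟨Finset.range r, i, Finset.card_range r, him, hir, Or.inr rfl,
          fun k hk => Or.inl (Finset.mem_range.mpr hk)⟩
    obtain ⟨g, hg, ⟨p, q, hpq, ho⟩, hz', hk⟩ := exists_slopes_sub_midpoints (by omega) (hE J hJ)
    have htouch : ∀ k, k ∈ J ∨ k = i → k ∈ J ∨ ∃ y, y ≠ 0 ∧ P = vt (k : ℕ) y := by
      rintro k (h | rfl)
      exacts [Or.inl h, Or.inr ⟨y, hy, hPy⟩]
    have h2 := hP (hz ((1 / 2 : ℝ) : Circ m))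
    have := slopes_le_neg_two hg hpq (fun w hw => by
      rcases htri w with ⟨k, hkm, rfl⟩ | h
      · obtain ⟨a, b, hab, h⟩ := hk k hkm
        have h2 := hP (hz (ipt m (k : ℕ)))
        refine ⟨a, b, hab, ?_⟩
        split_ifs at h with h3 h4
        · omega
        · exact absurd (htouch k (hJr k h3)) h4
        · omega
        · omega
      · obtain ⟨a, b, hab, h3⟩ := hz' w hw h
        exact ⟨a, b, hab, (hP _).trans h3⟩) (coe_half_ne_ipt (s : ℕ)).symm (by
      obtain ⟨a, b, hab, h⟩ := hk s hsm
      have h2 := hP (hz (ipt m (s : ℕ)))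
      rw [if_neg hsr, if_pos (htouch s hs)] at h
      exact ⟨a, b, hab, by omega⟩)
    omega

lemma divRank_cliffordDivisor {r : ℕ} (h1 : 1 ≤ r) (hr : r + 2 ≤ m) :
    divRank (Necklace m) (cliffordDivisor m r) = r :=
  divRank_eq hasStarCharts (rankGE_cliffordDivisor r)
    (not_rankGE_succ (not_rankGE_sub_single h1 hr (hz 0)))

lemma isFreeDivisor_cliffordDivisor {r : ℕ} (h1 : 1 ≤ r) (hr : r + 2 ≤ m) :
    IsFreeDivisor (Necklace m) (cliffordDivisor m r) := by
  rw [IsFreeDivisor, divRank_cliffordDivisor h1 hr]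
  exact ⟨effective_cliffordDivisor r, by exact_mod_cast h1,
    fun P => divRank_lt hasStarCharts (not_rankGE_sub_single h1 hr P)⟩

end Necklace

end

/-- For all integers `g, r` with `1 ≤ r ≤ g - 3` there is a metric graph
of genus `g` carrying a free effective divisor `D` of degree `2r + 1` with `rk(D) = r`;
in particular `D` has Clifford index `deg(D) - 2·rk(D) = 1`. -/
theorem statement1 (g r : ℤ) (hr : 1 ≤ r) (hrg : r ≤ g - 3) :
    ∃ (G : MetricGraph) (D : Divisor G.carrier),
      graphGenus G.carrier = g ∧ Effective D ∧ divDeg D = 2 * r + 1 ∧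
      divRank G.carrier D = r ∧ IsFreeDivisor G.carrier D ∧
      divDeg D - 2 * divRank G.carrier D = 1 := by
  obtain ⟨k, rfl⟩ := Int.eq_ofNat_of_zero_le (zero_le_one.trans hr)
  obtain ⟨m, hm⟩ := Int.eq_ofNat_of_zero_le (by omega : 0 ≤ g - 1)
  have hk : 1 ≤ k := by omega
  have hkm : k + 2 ≤ m := by omega
  have : Fact (3 ≤ m) := ⟨by omega⟩
  refine ⟨⟨Necklace m, Necklace.isMetricGraph⟩, Necklace.cliffordDivisor m k, ?_,
    Necklace.effective_cliffordDivisor k, Necklace.divDeg_cliffordDivisor k,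
    Necklace.divRank_cliffordDivisor hk hkm, Necklace.isFreeDivisor_cliffordDivisor hk hkm, ?_⟩
  · exact Necklace.genus_eq.trans (by omega)
  · change divDeg (Necklace.cliffordDivisor m k)
      - 2 * divRank (Necklace m) (Necklace.cliffordDivisor m k) = 1
    rw [Necklace.divDeg_cliffordDivisor, Necklace.divRank_cliffordDivisor hk hkm]
    ring
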